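/- arXiv:1112.5484 — 4 statements merged into one kernel-verified Lean document; each statement's English description precedes it below -/
import Mathlib

section
/- For every n ≥ 2 and every finite field F of cardinality q, with the possible exception of the case n = 4 and q = 2, there exists a group word w(x_1,x_2) in the free group F_2 on two generators such that the set of values of w in SL_n(F) consists exactly of the identity and all transvections of SL_n(F). -/
/-- The set of values of a word `w ∈ F_d` in a group `G`:
`G_w = { w(g₁,…,g_d)^{±1} : gᵢ ∈ G }`. -/
def wordValues {d : ℕ} (w : FreeGroup (Fin d)) (G : Type*) [Group G] : Set G :=
  {g | ∃ f : Fin d → G, FreeGroup.lift f w = g ∨ FreeGroup.lift f w = g⁻¹}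

/-- A transvection in `SL_n(F)`: `g ≠ 1`, `g - 1` has rank 1 and `(g - 1)² = 0`. -/
def IsTransvection {n : ℕ} {F : Type*} [Field F]
    (g : Matrix.SpecialLinearGroup (Fin n) F) : Prop :=
  g ≠ 1 ∧ ((g : Matrix (Fin n) (Fin n) F) - 1).rank = 1 ∧
    ((g : Matrix (Fin n) (Fin n) F) - 1) ^ 2 = 0

section Helpers

open Polynomial Module

lemma pPart_exp {B : Type*} [Group B] [Finite B] (p : ℕ) [Fact p.Prime] :
    ∃ j : ℕ, (∀ y : B, ∃ s, (y ^ j) ^ p ^ s = 1) ∧ ∃ t, j = p * t + 1 := by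
  have hp : p.Prime := Fact.out
  obtain ⟨s, m, hm, hc⟩ := Nat.exists_eq_pow_mul_and_not_dvd (Nat.card_pos (α := B)).ne' p hp.ne_one
  have hcop : m.Coprime p := ((Nat.Prime.coprime_iff_not_dvd hp).2 hm).symm
  have hp2 := hp.two_le
  have hm0 : 0 < m := Nat.pos_of_ne_zero (by rintro rfl; simp at hm)
  refine ⟨m ^ (p - 1), fun y => ⟨s, ?_⟩, ?_⟩
  · have h1 : m ∣ m ^ (p-1) := dvd_pow_self _ (by omega)
    rw [← pow_mul]
    apply orderOf_dvd_iff_pow_eq_one.1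
    refine (orderOf_dvd_natCard y).trans ?_
    rw [hc, mul_comm]
    exact mul_dvd_mul_right h1 _
  · have := Nat.ModEq.pow_totient hcop
    rw [Nat.totient_prime hp] at this
    have h2 := (Nat.modEq_iff_dvd' (Nat.one_le_pow _ _ hm0)).1 this.symm
    obtain ⟨t, ht⟩ := h2
    have := Nat.one_le_pow (p-1) m hm0
    exact ⟨t, by omega⟩

lemma gcd_lcm_dvd {M a b T : ℕ} (hM : M ≠ 0) (ha : a ≠ 0) (hb : b ≠ 0) (hT : T ≠ 0)
    (h1 : M.gcd a ∣ T) (h2 : M.gcd b ∣ T) : M.gcd (a.lcm b) ∣ T := by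
  have hl : a.lcm b ≠ 0 := Nat.lcm_ne_zero ha hb
  have e1 : M.gcd (a.lcm b) ≠ 0 := Nat.gcd_ne_zero_left hM
  have e2 : M.gcd a ≠ 0 := Nat.gcd_ne_zero_left hM
  have e3 : M.gcd b ≠ 0 := Nat.gcd_ne_zero_left hM
  rw [← Nat.factorization_le_iff_dvd (by assumption) hT] at *
  rw [Nat.factorization_gcd (by assumption) (by assumption)] at *
  rw [Nat.factorization_lcm (by assumption) (by assumption)]
  intro p
  have := h1 p
  have := h2 p
  simp at *
  omega

lemma arith (q n : ℕ) (hq : 2 ≤ q) (hn : 3 ≤ n) : ∃ k, 0 < k ∧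
    (∀ d, 1 ≤ d → d ≤ n → d ≠ n - 1 → q ^ d - 1 ∣ k) ∧ ¬ (q ^ (n - 1) - 1 ∣ k * (q - 1)) := by
  have hpos : ∀ d, 1 ≤ d → 0 < q ^ d - 1 := fun d hd => by
    have : q ^ 1 ≤ q ^ d := Nat.pow_le_pow_right (by omega) hd
    simp at this; omega
  have hcast : ∀ d, ((q ^ d - 1 : ℕ) : ℤ) = (q : ℤ) ^ d - 1 := fun d => by
    rw [Nat.cast_sub (Nat.one_le_pow _ _ (by omega))]; simp
  set M := q ^ (n - 1) - 1 with hM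
  have hM0 : 0 < M := hpos _ (by omega)
  -- cyclotomic value
  obtain ⟨Φ, hΦ⟩ : ∃ Φ : ℕ, (Φ : ℤ) = (Polynomial.cyclotomic (n - 1) ℤ).eval (q : ℤ) := by
    refine ⟨((Polynomial.cyclotomic (n - 1) ℤ).eval (q : ℤ)).toNat, ?_⟩
    rw [Int.toNat_of_nonneg]
    exact (Polynomial.cyclotomic_pos' (n - 1) (by exact_mod_cast (by omega : 1 < q))).le
  have hΦq : q - 1 < Φ := by
    have h := Polynomial.sub_one_pow_totient_lt_cyclotomic_eval (n := n - 1) (q := (q : ℝ))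
      (by omega) (by exact_mod_cast (by omega : 1 < q))
    have h2 : (Polynomial.cyclotomic (n - 1) ℝ).eval (q : ℝ) = (Φ : ℝ) := by
      have : (Φ : ℝ) = ((Φ : ℤ) : ℝ) := by simp
      rw [this, hΦ, ← Polynomial.map_cyclotomic_int (n - 1) ℝ]
      have := Polynomial.eval_intCast_map (Int.castRingHom ℝ) (Polynomial.cyclotomic (n - 1) ℤ) (q : ℤ)
      simpa using this
    rw [h2] at h
    have h3 : ((q - 1 : ℕ) : ℝ) = (q : ℝ) - 1 := by rw [Nat.cast_sub (by omega)]; simp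
    rw [← h3] at h
    have h4 : (q - 1) ^ (n - 1).totient < Φ := by exact_mod_cast h
    refine lt_of_le_of_lt ?_ h4
    apply Nat.le_self_pow
    exact (Nat.totient_pos.2 (by omega)).ne'
  have hdvd : ∀ d, d ∣ n - 1 → d ≠ n - 1 → (q ^ d - 1) * Φ ∣ M := by
    intro d hd hne
    have h := Polynomial.X_pow_sub_one_mul_cyclotomic_dvd_X_pow_sub_one_of_dvd ℤ
      (d := d) (n := n - 1) (Nat.mem_properDivisors.2 ⟨hd, lt_of_le_of_ne (Nat.le_of_dvd (by omega) hd) hne⟩)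
    have h2 := Polynomial.eval_dvd (x := (q : ℤ)) h
    simp only [Polynomial.eval_mul, Polynomial.eval_sub, Polynomial.eval_pow, Polynomial.eval_X, Polynomial.eval_one, ← hΦ, ← hcast] at h2
    exact_mod_cast h2
  obtain ⟨T, hT⟩ : Φ ∣ M := (Dvd.intro_left _ rfl).trans (hdvd 1 (one_dvd _) (by omega))
  have hT0 : T ≠ 0 := by rintro rfl; omega
  have hΦ0 : 0 < Φ := by omega
  have key : ∀ d, 1 ≤ d → d ≤ n → d ≠ n - 1 → M.gcd (q ^ d - 1) ∣ T := by
    intro d h1 h2 h3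
    have hg : M.gcd (q ^ d - 1) = q ^ ((n-1).gcd d) - 1 := Nat.pow_sub_one_gcd_pow_sub_one _ _ _
    rw [hg]
    have := hdvd ((n-1).gcd d) (Nat.gcd_dvd_left _ _) (by
      intro h
      have h4 : n - 1 ∣ d := h ▸ Nat.gcd_dvd_right _ _
      obtain ⟨c, hc⟩ := h4
      have : c ≠ 0 := by rintro rfl; omega
      have : c ≠ 1 := by rintro rfl; omega
      have : (n-1)*2 ≤ (n-1)*c := Nat.mul_le_mul_left _ (by omega)
      omega)
    rw [hT, mul_comm] at this
    exact Nat.dvd_of_mul_dvd_mul_left hΦ0 this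
  have hfin : ∀ s : Finset ℕ, (∀ d ∈ s, 1 ≤ d ∧ d ≤ n ∧ d ≠ n - 1) →
      ∃ k, 0 < k ∧ (∀ d ∈ s, q ^ d - 1 ∣ k) ∧ M.gcd k ∣ T := by
    intro s
    induction s using Finset.induction_on with
    | empty => intro _; exact ⟨1, by simp⟩
    | insert d s hd ih =>
      intro h
      obtain ⟨k, hk, hk1, hk2⟩ := ih (fun d hd => h d (Finset.mem_insert_of_mem hd))
      obtain ⟨a1, a2, a3⟩ := h d (Finset.mem_insert_self _ _)
      refine ⟨k.lcm (q ^ d - 1), Nat.lcm_pos hk (hpos _ a1), ?_, ?_⟩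
      · intro e he
        rcases Finset.mem_insert.1 he with rfl | he
        · exact Nat.dvd_lcm_right _ _
        · exact (hk1 e he).trans (Nat.dvd_lcm_left _ _)
      · exact gcd_lcm_dvd hM0.ne' hk.ne' (hpos _ a1).ne' hT0 hk2 (key d a1 a2 a3)
  obtain ⟨k, hk, hk1, hk2⟩ := hfin ((Finset.Icc 1 n).erase (n - 1)) (by
    intro d hd; simp at hd; omega)
  refine ⟨k, hk, fun d h1 h2 h3 => hk1 d (by simp; omega), fun hcon => ?_⟩
  have h1 : M ∣ M.gcd k * (q - 1) := by
    rw [← Nat.gcd_mul_right]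
    exact Nat.dvd_gcd (Dvd.intro _ rfl) hcon
  have h2 : M ∣ T * (q - 1) := h1.trans (Nat.mul_dvd_mul_right hk2 _)
  rw [hT, mul_comm Φ T] at h2
  have h3 := Nat.dvd_of_mul_dvd_mul_left (Nat.pos_of_ne_zero hT0) h2
  have := Nat.le_of_dvd (by omega) h3
  omega

lemma groupLemma {B G : Type*} [Group B] [Finite B] [Group G] [Finite G] (p : ℕ) [Fact p.Prime]
    (φ : B →* G) (E : Subgroup G) (hE : IsPGroup p E) (X Y : B)
    (hc : ∀ x ∈ E, φ X * x * (φ X)⁻¹ ∈ E) (he : φ Y ∈ E) (hep : (φ Y) ^ p = 1) :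
    ∃ Q : Subgroup B, IsPGroup p Q ∧ ∃ g u : B, φ g ∈ E ∧ u ∈ Q ∧ φ u = φ Y ∧
      ∀ x ∈ Q, (g * X) * x * (g * X)⁻¹ ∈ Q := by
  obtain ⟨j, hj, t, ht⟩ := pPart_exp (B := B) p
  set P : Subgroup B := E.comap φ with hP
  have hmap : P.map (MulAut.conj X).toMonoidHom = P := by
    have hle : P.map (MulAut.conj X).toMonoidHom ≤ P := by
      rintro _ ⟨x, hx, rfl⟩
      have := hc _ hx
      simpa [hP] using this
    apply Subgroup.eq_of_le_of_card_ge hle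
    rw [Subgroup.card_map_of_injective (MulAut.conj X).injective]
  let α : MulAut P := ((MulAut.conj X).subgroupMap P).trans (MulEquiv.subgroupCongr hmap)
  have hα : ∀ x : P, ((α x : P) : B) = X * x * X⁻¹ := fun x => rfl
  let y : P := ⟨Y ^ j, by simpa [hP] using E.pow_mem he j⟩
  have hy : IsPGroup p (Subgroup.zpowers y) := by
    obtain ⟨s, hs⟩ := hj Y
    rw [isPGroup_iff_pow_pow_eq_one]
    rintro ⟨_, z, rfl⟩
    refine ⟨s, ?_⟩
    apply Subtype.ext
    apply Subtype.ext
    simp only [y, SubgroupClass.coe_pow, SubgroupClass.coe_zpow, OneMemClass.coe_one]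
    rw [← zpow_natCast, ← zpow_mul, mul_comm, zpow_mul, zpow_natCast, hs, one_zpow]
  obtain ⟨Q, hQ⟩ := hy.exists_le_sylow
  obtain ⟨g, hg⟩ := MulAction.exists_smul_eq P (α • Q) Q
  refine ⟨(Q : Subgroup P).map P.subtype, Q.2.map _, g, y, g.2, ?_, ?_, ?_⟩
  · exact ⟨y, hQ (Subgroup.mem_zpowers y), rfl⟩
  · show φ (Y ^ j) = φ Y
    rw [map_pow, ht, pow_add, pow_mul, hep, one_pow, one_mul, pow_one]
  · rintro _ ⟨x, hx, rfl⟩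
    refine ⟨g * α x * g⁻¹, ?_, ?_⟩
    · have : g * α x * g⁻¹ ∈ ((g • α • Q : Sylow p P) : Set P) := by
        refine ⟨α x, ⟨x, hx, rfl⟩, rfl⟩
      rw [hg] at this
      exact this
    · simp [hα, mul_assoc]

lemma wordLemma {G : Type*} [Group G] [Finite G] (p : ℕ) [Fact p.Prime] (k : ℕ) (S : Set G)
    (h1 : 1 ∈ S)
    (hS : ∀ a : G, a ^ k = 1 ∨ ∀ R : Subgroup G, IsPGroup p R → (∀ r ∈ R, a * r * a⁻¹ ∈ R) →
      ∀ r ∈ R, r ∈ S)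
    (E : Subgroup G) (hE : IsPGroup p E) (c e : G) (hc : ∀ x ∈ E, c * x * c⁻¹ ∈ E)
    (he : e ∈ E) (hep : e ^ p = 1)
    (hne : ∀ y ∈ E, (y * c) ^ k * e * ((y * c) ^ k)⁻¹ * e⁻¹ ≠ 1) :
    ∃ w : FreeGroup (Fin 2), (∀ f : Fin 2 → G, FreeGroup.lift f w ∈ S) ∧
      ∃ f : Fin 2 → G, FreeGroup.lift f w ≠ 1 := by
  let ev : FreeGroup (Fin 2) →* ((Fin 2 → G) → G) := FreeGroup.lift (fun i f => f i)
  have hev : ∀ f w, ev w f = FreeGroup.lift f w := by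
    intro f w
    have : (Pi.evalMonoidHom (fun _ => G) f).comp ev = FreeGroup.lift f := by
      ext i; simp [ev]
    rw [← this]; rfl
  let φ : (Fin 2 → G) → (ev.range →* G) := fun f =>
    (Pi.evalMonoidHom (fun _ => G) f).comp ev.range.subtype
  let r : FreeGroup (Fin 2) → ev.range := ev.rangeRestrict
  have hφ : ∀ f w, φ f (r w) = FreeGroup.lift f w := fun f w => hev f w
  let f1 : Fin 2 → G := ![c, e]
  obtain ⟨Q, hQ, g, u, hg, hu, hue, hn⟩ := groupLemma p (φ f1) E hE
    (r (FreeGroup.of 0)) (r (FreeGroup.of 1))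
    (by rw [hφ]; simpa [f1] using hc) (by rw [hφ]; simpa [f1] using he)
    (by rw [hφ]; simpa [f1] using hep)
  set C := g * r (FreeGroup.of 0) with hC
  have hCk : ∀ m : ℕ, ∀ x ∈ Q, C ^ m * x * (C ^ m)⁻¹ ∈ Q := by
    intro m
    induction m with
    | zero => intro x hx; simpa using hx
    | succ m ih =>
      intro x hx
      have := hn _ (ih x hx)
      rw [pow_succ']
      simpa [mul_assoc] using this
  obtain ⟨w, hw⟩ := ev.rangeRestrict_surjective (C ^ k * u * (C ^ k)⁻¹ * u⁻¹)
  have hw' : r w = C ^ k * u * (C ^ k)⁻¹ * u⁻¹ := hw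
  refine ⟨w, fun f => ?_, f1, ?_⟩
  · rw [← hφ, hw']
    rcases hS (φ f C) with h | h
    · simp [h, h1]
    · apply h (Q.map (φ f)) (hQ.map _)
      · rintro _ ⟨x, hx, rfl⟩
        exact ⟨_, hn x hx, by simp⟩
      · exact ⟨_, Q.mul_mem (hCk k u hu) (Q.inv_mem hu), rfl⟩
  · rw [← hφ, hw']
    have := hne _ hg
    simp only [map_mul, map_pow, map_inv, hue, hC]
    rw [hφ, hφ]
    simpa [f1] using this


lemma fixedVec {R F M : Type*} [Group R] [Field F] [AddCommGroup M] [Module F M] [Finite M]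
    [Nontrivial M] (p : ℕ) [Fact p.Prime] [CharP F p] (hR : IsPGroup p R) (ρ : R →* Module.End F M) :
    ∃ v : M, v ≠ 0 ∧ ∀ r, ρ r v = v := by
  let _ : MulAction R M := MulAction.compHom M ρ
  have hsm : ∀ (r : R) (v : M), r • v = ρ r v := fun _ _ => rfl
  obtain ⟨x, hx⟩ := exists_ne (0 : M)
  have hd : p ∣ Nat.card M := by
    have h1 : addOrderOf x = p := by
      apply addOrderOf_eq_prime _ hx
      rw [← Nat.cast_smul_eq_nsmul F, CharP.cast_eq_zero, zero_smul]
    rw [← h1]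
    exact addOrderOf_dvd_natCard x
  obtain ⟨b, hb, hne⟩ := hR.exists_fixed_point_of_prime_dvd_card_of_fixed_point M hd (a := 0)
    (by intro r; rw [hsm, map_zero])
  exact ⟨b, hne.symm, fun r => by rw [← hsm]; exact hb r⟩

lemma invDichotomy {F V : Type*} [Field F] [AddCommGroup V] [Module F V] [FiniteDimensional F V]
    (a : Module.End F V) (f g : F[X]) (hf : Irreducible f) (hfg : a.charpoly = f * g)
    (hg : g.natDegree = 1) (hf2 : 2 ≤ f.natDegree) (hV : finrank F V = f.natDegree + 1) :
    ∃ W L : Submodule F V, W ⊔ L = ⊤ ∧ finrank F L ≤ 1 ∧ f.natDegree ≤ finrank F W ∧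
      (∀ v ∈ L, a v ∈ L) ∧ ∀ A : Submodule F V, (∀ v ∈ A, a v ∈ A) → A ≤ L ∨ W ≤ A := by
  have hcop : IsCoprime f g := by
    refine (hf.coprime_iff_not_dvd).2 fun h => ?_
    have := natDegree_le_of_dvd h (by rintro rfl; simp at hg)
    omega
  have hAp : ∀ A : Submodule F V, (∀ v ∈ A, a v ∈ A) → ∀ (P : F[X]), ∀ v ∈ A, aeval a P v ∈ A := by
    intro A hA P v hv
    induction P using Polynomial.induction_on' with
    | add p q hp hq => simpa using A.add_mem hp hq
    | monomial k c =>
      have : ∀ k : ℕ, (a ^ k) v ∈ A := by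
        intro k
        induction k with
        | zero => simpa
        | succ k ih => rw [pow_succ']; exact hA _ ih
      simpa [aeval_monomial] using A.smul_mem c (this k)
  have hker : ∀ P : F[X], ∀ u ∈ LinearMap.ker (aeval a P), a u ∈ LinearMap.ker (aeval a P) := by
    intro P u hu
    have hc : aeval a P * a = a * aeval a P := by
      have h1 : aeval a (P * X) = aeval a (X * P) := by rw [mul_comm]
      simpa using h1
    have := LinearMap.congr_fun hc u
    simp only [Module.End.mul_apply] at this
    rw [LinearMap.mem_ker] at hu ⊢
    rw [this, hu, map_zero]
  set W := LinearMap.ker (aeval a f) with hW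
  set L := LinearMap.ker (aeval a g) with hL
  have hfga : aeval a (f * g) = 0 := by rw [← hfg]; exact LinearMap.aeval_self_charpoly a
  have hsup : W ⊔ L = ⊤ := by
    rw [hW, hL, sup_ker_aeval_eq_ker_aeval_mul_of_coprime a hcop, hfga, LinearMap.ker_zero]
  have hdis : Disjoint W L := disjoint_ker_aeval_of_isCoprime a hcop
  have hdim : finrank F W + finrank F L = f.natDegree + 1 := by
    rw [← hV, ← Submodule.finrank_sup_add_finrank_inf_eq, hsup, hdis.eq_bot]
    simp
  obtain ⟨μ, hμ⟩ : ∃ μ, g.IsRoot μ := by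
    exact Polynomial.exists_root_of_degree_eq_one (degree_eq_iff_natDegree_eq_of_pos one_pos |>.2 hg)
  have hLne : L ≠ ⊥ := by
    have h1 : a.HasEigenvalue μ := by
      rw [Module.End.hasEigenvalue_iff_isRoot_charpoly, hfg]
      exact hμ.dvd (Dvd.intro_left _ rfl)
    obtain ⟨v, hv⟩ := h1.exists_hasEigenvector
    intro h
    apply hv.2
    have : v ∈ L := by
      rw [hL, LinearMap.mem_ker, Module.End.aeval_apply_of_hasEigenvector hv, hμ, zero_smul]
    simpa [h] using this
  have hLpos : 1 ≤ finrank F L := Submodule.one_le_finrank_iff.2 hLne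
  have hbig : ∀ A : Submodule F V, (∀ v ∈ A, a v ∈ A) → ∀ v ∈ A, v ∈ W → v ≠ 0 →
      W ≤ A ∧ f.natDegree ≤ finrank F W := by
    intro A hA v hv hvW hv0
    let T : degreeLT F f.natDegree →ₗ[F] V :=
      (LinearMap.applyₗ v).comp (((aeval a).toLinearMap : F[X] →ₗ[F] Module.End F V).comp (degreeLT F f.natDegree).subtype)
    have hT : ∀ P, T P = aeval a (P : F[X]) v := fun P => rfl
    have hinj : Function.Injective T := by
      rw [← LinearMap.ker_eq_bot, LinearMap.ker_eq_bot']
      rintro ⟨P, hP⟩ h0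
      rw [hT] at h0
      by_contra hne
      have hP0 : P ≠ 0 := fun h => hne (by simp [h])
      have hcop2 : IsCoprime f P := by
        refine (hf.coprime_iff_not_dvd).2 fun h => ?_
        have h3 := natDegree_le_of_dvd h hP0
        rw [mem_degreeLT] at hP
        have := (natDegree_lt_iff_degree_lt hP0).2 hP
        omega
      have := (disjoint_ker_aeval_of_isCoprime a hcop2).le_bot ⟨hvW, h0⟩
      exact hv0 (by simpa using this)
    have hr : LinearMap.range T ≤ A ⊓ W := by
      rintro _ ⟨P, rfl⟩
      rw [hT]
      refine ⟨hAp A hA _ v hv, hAp W ?_ _ v hvW⟩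
      intro u hu
      exact hker f u hu
    have h1 : finrank F (LinearMap.range T) = f.natDegree := by
      rw [LinearMap.finrank_range_of_inj hinj, (degreeLTEquiv F f.natDegree).finrank_eq]
      simp
    have h2 : finrank F (A ⊓ W : Submodule F V) ≥ finrank F W := by
      have := Submodule.finrank_mono hr
      omega
    have := Submodule.eq_of_le_of_finrank_le (inf_le_right : A ⊓ W ≤ W) h2
    refine ⟨this ▸ inf_le_left, ?_⟩
    rw [← h1]
    exact Submodule.finrank_mono (hr.trans inf_le_right)
  have hWne : W ≠ ⊥ := by
    intro h
    have hLt : L = ⊤ := by rwa [h, bot_sup_eq] at hsup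
    have hlin : g = C (g.leadingCoeff) * (X - C μ) := by
      obtain ⟨h, hh⟩ := dvd_iff_isRoot.2 hμ
      have hg0 : g ≠ 0 := by rintro rfl; simp at hg
      have hh0 : h ≠ 0 := by rintro rfl; simp at hh; exact hg0 hh
      have : h.natDegree = 0 := by
        rw [hh, natDegree_mul (X_sub_C_ne_zero _) hh0] at hg
        simp at hg; exact hg
      obtain ⟨c, rfl⟩ := natDegree_eq_zero.1 this
      have hlc : g.leadingCoeff = c := by rw [hh]; simp
      rw [hlc, hh, mul_comm]
    have ha : a - μ • 1 = 0 := by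
      have h1 : aeval a g = 0 := LinearMap.ker_eq_top.1 hLt
      rw [hlin] at h1
      have hg0 : g ≠ 0 := by rintro rfl; simp at hg
      simp only [map_mul, aeval_C, map_sub, aeval_X, Algebra.algebraMap_eq_smul_one, smul_mul_assoc, one_mul] at h1
      exact (smul_eq_zero.1 h1).resolve_left (leadingCoeff_ne_zero.2 hg0)
    have h1 := LinearMap.charpoly_sub_smul a μ
    rw [ha, hfg, LinearMap.charpoly_zero, mul_comp] at h1
    have h2 : f.comp (X + C μ) ∣ X ^ finrank F V := ⟨_, h1⟩
    obtain ⟨i, hi, hass⟩ := (dvd_prime_pow prime_X _).1 h2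
    have hi0 : i ≠ 0 := by
      rintro rfl
      have := natDegree_eq_of_degree_eq (degree_eq_degree_of_associated hass)
      rw [natDegree_comp] at this
      simp at this
      omega
    have h3 : (X : F[X]) ∣ f.comp (X + C μ) := (dvd_pow_self X hi0).trans hass.symm.dvd
    rw [X_dvd_iff, coeff_zero_eq_eval_zero, eval_comp] at h3
    simp at h3
    have := degree_eq_one_of_irreducible_of_root hf h3
    have := natDegree_eq_of_degree_eq_some (n := 1) this
    omega
  have hWdeg : f.natDegree ≤ finrank F W := by
    obtain ⟨v, hv, hv0⟩ := (Submodule.ne_bot_iff _).1 hWne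
    exact (hbig W (hker f) v hv hv hv0).2
  refine ⟨W, L, hsup, by omega, hWdeg, ?_, ?_⟩
  · exact hker g
  · intro A hA
    by_cases h : A ≤ L
    · exact Or.inl h
    · right
      obtain ⟨u, hu, huL⟩ := Set.not_subset.1 h
      refine (hbig A hA (aeval a g u) (hAp A hA _ _ hu) ?_ huL).1
      rw [hW, LinearMap.mem_ker, ← Module.End.mul_apply, ← map_mul, hfga, LinearMap.zero_apply]


lemma rankLemma {R F V : Type*} [Group R] [Field F] [Finite F] [AddCommGroup V] [Module F V]
    [FiniteDimensional F V] (p : ℕ) [Fact p.Prime] [CharP F p] (hR : IsPGroup p R)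
    (ρ : R →* Module.End F V)
    (a : Module.End F V) (f g : F[X]) (hf : Irreducible f) (hfg : a.charpoly = f * g)
    (hg : g.natDegree = 1) (hf2 : 2 ≤ f.natDegree) (hV : finrank F V = f.natDegree + 1)
    (har : ∀ r, ∃ r', ρ r * a = a * ρ r') (r : R) :
    finrank F (LinearMap.range (ρ r - 1)) ≤ 1 := by
  have : Finite V := Module.finite_of_finite F
  have : Nontrivial V := Module.nontrivial_of_finrank_pos (R := F) (by omega)
  obtain ⟨W, L, hsup, hL1, hWd, hLa, hdich⟩ := invDichotomy a f g hf hfg hg hf2 hV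
  have har' : ∀ r, ∃ r', ∀ v, ρ r (a v) = a (ρ r' v) := fun r => by
    obtain ⟨r', h⟩ := har r
    exact ⟨r', fun v => LinearMap.congr_fun h v⟩
  let U : Submodule F V := ⨅ r, LinearMap.ker (ρ r - 1)
  have hU : ∀ v, v ∈ U ↔ ∀ r, ρ r v = v := by
    intro v; simp [U, Submodule.mem_iInf, sub_eq_zero]
  have hUa : ∀ v ∈ U, a v ∈ U := by
    intro v hv
    rw [hU] at hv ⊢
    intro r
    obtain ⟨r', h⟩ := har' r
    rw [h, hv]
  have hrn := LinearMap.finrank_range_add_finrank_ker (ρ r - 1)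
  rcases hdich U hUa with hle | hle
  · obtain ⟨u, hu0, hu⟩ := fixedVec p hR ρ
    have huU := (hU u).2 hu
    have hUL : U = L := by
      apply Submodule.eq_of_le_of_finrank_le hle
      have : 1 ≤ finrank F U := Submodule.one_le_finrank_iff.2 ((Submodule.ne_bot_iff _).2 ⟨u, huU, hu0⟩)
      omega
    have hLρ : ∀ r, L ≤ L.comap (ρ r) := by
      intro r v hv
      rw [Submodule.mem_comap]
      rw [← hUL, hU] at hv
      rw [hv, ← hUL, hU]; exact hv
    let ρ' : R →* Module.End F (V ⧸ L) :=
      { toFun := fun r => L.mapQ L (ρ r) (hLρ r)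
        map_one' := by
          ext v; simp
        map_mul' := by
          intro r s
          ext v; simp }
    have : Nontrivial (V ⧸ L) := by
      apply Module.nontrivial_of_finrank_pos (R := F)
      have := L.finrank_quotient_add_finrank
      omega
    have : Finite (V ⧸ L) := Module.finite_of_finite F
    obtain ⟨x, hx0, hx⟩ := fixedVec p hR ρ'
    obtain ⟨v, rfl⟩ := L.mkQ_surjective x
    let U2 : Submodule F V := ⨅ r, L.comap (ρ r - 1)
    have hU2 : ∀ v, v ∈ U2 ↔ ∀ r, ρ r v - v ∈ L := by
      intro v; simp [U2, Submodule.mem_iInf]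
    have hU2a : ∀ v ∈ U2, a v ∈ U2 := by
      intro v hv
      rw [hU2] at hv ⊢
      intro r
      obtain ⟨r', h⟩ := har' r
      rw [h, ← map_sub]
      exact hLa _ (hv r')
    have hLU2 : L ≤ U2 := by
      intro v hv
      rw [hU2]
      intro r
      exact L.sub_mem (hLρ r hv) hv
    have hvU2 : v ∈ U2 := by
      rw [hU2]
      intro r
      have := hx r
      exact (Submodule.Quotient.eq L).1 this
    rcases hdich U2 hU2a with h2 | h2
    · exact absurd ((Submodule.Quotient.mk_eq_zero L).2 (h2 hvU2)) hx0
    · have htop : U2 = ⊤ := top_unique (hsup ▸ sup_le h2 hLU2)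
      refine le_trans (Submodule.finrank_mono ?_) hL1
      rintro _ ⟨v, rfl⟩
      have : v ∈ U2 := htop ▸ Submodule.mem_top
      exact (hU2 v).1 this r
  · have : W ≤ LinearMap.ker (ρ r - 1) := hle.trans (iInf_le _ r)
    have := Submodule.finrank_mono this
    omega

lemma isTransv_of_rank {n : ℕ} {F : Type*} [Field F] (p : ℕ) [Fact p.Prime] [CharP F p]
    (g : Matrix.SpecialLinearGroup (Fin n) F)
    (hr : finrank F (LinearMap.range (Matrix.toLin' (g : Matrix (Fin n) (Fin n) F) - 1)) ≤ 1)
    (hs : ((g : Matrix (Fin n) (Fin n) F) - 1) ^ (2 : ℕ) = 0 ∨ ∃ s, g ^ p ^ s = 1) :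
    g = 1 ∨ IsTransvection g := by
  by_cases hg : g = 1
  · exact Or.inl hg
  right
  set A : Matrix (Fin n) (Fin n) F := (g : Matrix (Fin n) (Fin n) F) - 1 with hA
  have hA0 : A ≠ 0 := by
    intro h
    apply hg
    apply Subtype.ext
    exact sub_eq_zero.1 h
  have hlin : Matrix.toLin' (g : Matrix (Fin n) (Fin n) F) - 1 = Matrix.toLin' A := by
    rw [hA, map_sub, Matrix.toLin'_one]; rfl
  rw [hlin] at hr
  have hrank : A.rank = finrank F (LinearMap.range (Matrix.toLin' A)) := rfl
  refine ⟨hg, ?_, ?_⟩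
  · have : A.rank ≠ 0 := by
      rw [hrank]
      intro h
      rw [Submodule.finrank_eq_zero, LinearMap.range_eq_bot] at h
      exact hA0 (by simpa using h)
    rw [← hrank] at hr
    exact le_antisymm hr (Nat.one_le_iff_ne_zero.2 this)
  · rcases hs with hs | ⟨s, hs⟩
    · exact hs
    have hne : Nonempty (Fin n) := by
      by_contra h
      rw [not_nonempty_iff] at h
      exact hA0 (Subsingleton.elim _ _)
    have hnil : A ^ p ^ s = 0 := by
      rw [hA, sub_pow_char_pow_of_commute _ _ (Commute.one_right _)]
      have := congrArg (fun x : Matrix.SpecialLinearGroup (Fin n) F => (x : Matrix (Fin n) (Fin n) F)) hs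
      simp only [Matrix.SpecialLinearGroup.coe_pow, Matrix.SpecialLinearGroup.coe_one] at this
      rw [this]; simp
    set N := Matrix.toLin' A with hN
    have hNnil : N ^ p ^ s = 0 := by
      rw [hN, ← Matrix.toLin'_pow, hnil, map_zero]
    have hN2 : N * N = 0 := by
      refine LinearMap.ext fun x => ?_
      show N (N x) = 0
      generalize hx : N x = y
      by_contra hy
      have hy0 : y ≠ 0 := by rintro rfl; simp at hy
      obtain ⟨v, hv⟩ := finrank_le_one_iff.1 hr
      obtain ⟨c1, hc1⟩ := hv ⟨y, ⟨_, hx⟩⟩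
      obtain ⟨c2, hc2⟩ := hv ⟨N y, ⟨_, rfl⟩⟩
      have hc1' : c1 • (v : Fin n → F) = y := congrArg Subtype.val hc1
      have hc2' : c2 • (v : Fin n → F) = N y := congrArg Subtype.val hc2
      have hc10 : c1 ≠ 0 := by rintro rfl; simp at hc1'; exact hy0 hc1'.symm
      have hNy : N y = (c2 * c1⁻¹) • y := by
        rw [← hc2', ← hc1', smul_smul]
        congr 1; field_simp
      have hpow : ∀ k : ℕ, (N ^ k) y = (c2 * c1⁻¹) ^ k • y := by
        intro k
        induction k with
        | zero => simp
        | succ k ih => rw [pow_succ', Module.End.mul_apply, ih, map_smul, hNy, smul_smul, ← pow_succ]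
      have h0 := hpow (p ^ s)
      rw [hNnil] at h0
      have hz : (c2 * c1⁻¹) ^ p ^ s = 0 := by
        rcases smul_eq_zero.1 h0.symm with h | h
        · exact h
        · exact absurd h hy0
      have hz := eq_zero_of_pow_eq_zero hz
      rw [hz, zero_smul] at hNy
      exact hy hNy
    rw [pow_two]
    apply Matrix.toLin'.injective
    rw [Matrix.toLin'_mul, map_zero]
    exact hN2

lemma dvd_pow_of_irr {F : Type*} [Field F] (P Q : F[X]) (hP : P ≠ 0)
    (h : ∀ f, Irreducible f → f ∣ P → f ∣ Q) : ∃ N : ℕ, P ∣ Q ^ N := by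
  induction P using WfDvdMonoid.induction_on_irreducible with
  | zero => exact absurd rfl hP
  | unit u hu => exact ⟨0, hu.dvd⟩
  | mul a i ha hi ih =>
    obtain ⟨N, hN⟩ := ih ha (fun f hf hfa => h f hf (hfa.trans (Dvd.intro_left _ rfl)))
    refine ⟨N + 1, ?_⟩
    rw [pow_succ']
    exact mul_dvd_mul (h i hi (Dvd.intro _ rfl)) hN

lemma pow_eq_one_of_pow {G : Type*} [Group G] [Finite G] (p : ℕ) [Fact p.Prime] (x : G)
    (h : ∃ s, x ^ p ^ s = 1) : x ^ p ^ Nat.card G = 1 := by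
  obtain ⟨s, hs⟩ := h
  obtain ⟨j, hj, hx⟩ := (Nat.dvd_prime_pow (Fact.out : p.Prime)).1 (orderOf_dvd_of_pow_eq_one hs)
  apply orderOf_dvd_iff_pow_eq_one.1
  rw [hx]
  apply pow_dvd_pow
  have h1 : p ^ j ≤ Nat.card G := hx ▸ Nat.le_of_dvd Nat.card_pos (orderOf_dvd_natCard x)
  exact (Nat.lt_pow_self (Fact.out : p.Prime).one_lt).le.trans h1

lemma pow_isP {n : ℕ} {F : Type*} [Field F] [Finite F] (p : ℕ) [Fact p.Prime] [CharP F p]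
    (hn : n ≠ 0) (k : ℕ) (a : Matrix.SpecialLinearGroup (Fin n) F)
    (h : ∀ f, Irreducible f → f ∣ (a : Matrix (Fin n) (Fin n) F).charpoly →
      Nat.card F ^ f.natDegree - 1 ∣ k) : ∃ s, (a ^ k) ^ p ^ s = 1 := by
  have : Nonempty (Fin n) := ⟨⟨0, by omega⟩⟩
  set A := (a : Matrix (Fin n) (Fin n) F) with hA
  obtain ⟨N, hN⟩ := dvd_pow_of_irr A.charpoly (X ^ k - 1) A.charpoly_monic.ne_zero (by
    intro f hf hfA
    have h1 := (hf.natDegree_dvd_iff_dvd_X_pow_card_pow_sub_X (n := f.natDegree)).1 dvd_rfl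
    have hpos : 0 < Nat.card F ^ f.natDegree := pow_pos Nat.card_pos _
    have h2 : (X ^ (Nat.card F ^ f.natDegree) - X : F[X]) = X * (X ^ (Nat.card F ^ f.natDegree - 1) - 1) := by
      rw [mul_sub, mul_one, ← pow_succ', Nat.sub_add_cancel hpos]
    rw [h2] at h1
    have hX : ¬ f ∣ X := by
      intro hfX
      have := (hf.associated_of_dvd irreducible_X hfX).symm.dvd.trans hfA
      rw [X_dvd_iff] at this
      have h3 := Matrix.det_eq_sign_charpoly_coeff A
      rw [this, mul_zero, hA, a.2] at h3
      exact one_ne_zero h3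
    have h3 := (hf.prime.dvd_or_dvd h1).resolve_left hX
    refine h3.trans ?_
    obtain ⟨t, ht⟩ := h f hf hfA
    rw [ht, pow_mul]
    exact sub_one_dvd_pow_sub_one _ _)
  have h0 : (A ^ k - 1) ^ N = 0 := by
    obtain ⟨R, hR⟩ := hN
    have := congrArg (aeval A) hR
    simpa [Matrix.aeval_self_charpoly] using this
  have hNs : N ≤ p ^ N := (Nat.lt_pow_self (Fact.out : p.Prime).one_lt).le
  have h1 : (A ^ k - 1) ^ p ^ N = 0 := pow_eq_zero_of_le hNs h0
  rw [sub_pow_char_pow_of_commute _ _ (Commute.one_right _), one_pow, sub_eq_zero] at h1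
  refine ⟨N, Subtype.ext ?_⟩
  simpa using h1

lemma hS_holds {n : ℕ} {F : Type*} [Field F] [Finite F] (p : ℕ) [Fact p.Prime] [CharP F p]
    (hn : 3 ≤ n) (k : ℕ)
    (hk : ∀ d, 1 ≤ d → d ≤ n → d ≠ n - 1 → Nat.card F ^ d - 1 ∣ k)
    (a : Matrix.SpecialLinearGroup (Fin n) F) :
    a ^ (k * p ^ Nat.card (Matrix.SpecialLinearGroup (Fin n) F)) = 1 ∨
      ∀ R : Subgroup (Matrix.SpecialLinearGroup (Fin n) F), IsPGroup p R →
      (∀ r ∈ R, a * r * a⁻¹ ∈ R) → ∀ r ∈ R, r = 1 ∨ IsTransvection r := by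
  set A := (a : Matrix (Fin n) (Fin n) F) with hA
  have hdeg : A.charpoly.natDegree = n := by rw [Matrix.charpoly_natDegree_eq_dim]; simp
  by_cases h : ∃ f, Irreducible f ∧ f ∣ A.charpoly ∧ f.natDegree = n - 1
  · right
    intro R hR hnorm r hr
    obtain ⟨f, hf, ⟨g, hfg⟩, hfd⟩ := h
    have hg0 : g ≠ 0 := by rintro rfl; exact A.charpoly_monic.ne_zero (by simpa using hfg)
    have hgd : g.natDegree = 1 := by
      rw [hfg, natDegree_mul hf.ne_zero hg0] at hdeg
      omega
    let ρ : R →* Module.End F (Fin n → F) :=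
      ((Matrix.toLinAlgEquiv' : Matrix (Fin n) (Fin n) F ≃ₐ[F] _).toAlgHom.toMonoidHom.comp
        (Matrix.SpecialLinearGroup.coeMonoidHom)).comp R.subtype
    have hρ : ∀ x : R, ρ x = Matrix.toLin' ((x : Matrix.SpecialLinearGroup (Fin n) F) : Matrix (Fin n) (Fin n) F) := fun x => rfl
    have hinv : ∀ r ∈ R, a⁻¹ * r * a ∈ R := by
      have hpow : ∀ m : ℕ, ∀ r ∈ R, a ^ m * r * (a ^ m)⁻¹ ∈ R := by
        intro m
        induction m with
        | zero => intro r hr; simpa using hr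
        | succ m ih =>
          intro x hx
          have := hnorm _ (ih x hx)
          rw [pow_succ']
          simpa [mul_assoc] using this
      intro r hr
      have h1 := hpow (orderOf a - 1) r hr
      have h2 : a ^ (orderOf a - 1) = a⁻¹ := by
        rw [eq_inv_iff_mul_eq_one, ← pow_succ, Nat.sub_add_cancel (orderOf_pos a), pow_orderOf_eq_one]
      rw [h2] at h1
      simpa using h1
    have := rankLemma p hR ρ (Matrix.toLin' A) f g hf (by rw [Matrix.charpoly_toLin', hfg]) hgd (by omega)
      (by simp; omega) (by
        intro x
        refine ⟨⟨a⁻¹ * x * a, hinv _ x.2⟩, ?_⟩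
        rw [hρ, hρ]
        have e : (x : Matrix.SpecialLinearGroup (Fin n) F) * a = a * (a⁻¹ * x * a) := by group
        have e2 := congrArg (fun y : Matrix.SpecialLinearGroup (Fin n) F => Matrix.toLin' (y : Matrix (Fin n) (Fin n) F)) e
        simp only [Matrix.SpecialLinearGroup.coe_mul] at e2 ⊢
        rw [Matrix.toLin'_mul, Matrix.toLin'_mul A] at e2
        exact e2) ⟨r, hr⟩
    refine isTransv_of_rank p r this (Or.inr ?_)
    obtain ⟨s, hs⟩ := isPGroup_iff_pow_pow_eq_one.1 hR ⟨r, hr⟩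
    exact ⟨s, by simpa using congrArg Subtype.val hs⟩
  · left
    rw [pow_mul]
    apply pow_eq_one_of_pow
    apply pow_isP p (by omega)
    intro f hf hfA
    apply hk
    · exact hf.natDegree_pos
    · exact (natDegree_le_of_dvd hfA A.charpoly_monic.ne_zero).trans hdeg.le
    · intro hd
      exact h ⟨f, hf, hfA, hd⟩


lemma normalForm {F : Type*} [Field F] {n : ℕ} (hn : 2 ≤ n) (A : Module.End F (Fin n → F))
    (hr : finrank F (LinearMap.range A) = 1) (h2 : ∀ x, A (A x) = 0) :
    ∃ φ : (F × F × (Fin (n - 2) → F)) ≃ₗ[F] (Fin n → F), ∀ x, A (φ x) = φ (0, x.1, 0) := by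
  have hA : ∃ u, A u ≠ 0 := by
    by_contra! h
    have : A = 0 := LinearMap.ext h
    rw [this, LinearMap.range_zero, finrank_bot] at hr
    exact zero_ne_one hr
  obtain ⟨u, hu⟩ := hA
  have hk := A.finrank_range_add_finrank_ker
  rw [hr, finrank_fin_fun] at hk
  let v : LinearMap.ker A := ⟨A u, h2 u⟩
  have hv : v ≠ 0 := fun h => hu (congrArg Subtype.val h)
  obtain ⟨W, hW⟩ := Submodule.exists_isCompl (Submodule.span F {v})
  have hWd := Submodule.finrank_add_eq_of_isCompl hW
  rw [finrank_span_singleton hv] at hWd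
  have : Module.Free F W := Module.Free.of_divisionRing F W
  have ψ : (Fin (n - 2) → F) ≃ₗ[F] W := LinearEquiv.ofFinrankEq _ _ (by
    rw [finrank_fin_fun]; omega)
  let φ : (F × F × (Fin (n - 2) → F)) →ₗ[F] (Fin n → F) :=
    (LinearMap.toSpanSingleton F _ u).coprod
      ((LinearMap.toSpanSingleton F _ (A u)).coprod
        ((LinearMap.ker A).subtype ∘ₗ W.subtype ∘ₗ ψ.toLinearMap))
  have hφ : ∀ a b c, φ (a, b, c) = a • u + (b • A u + ((ψ c : LinearMap.ker A) : Fin n → F)) := by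
    intro a b c; rfl
  have hAφ : ∀ a b c, A (φ (a, b, c)) = a • A u := by
    intro a b c
    rw [hφ, map_add, map_add, map_smul, map_smul, h2]
    have : A ((ψ c : LinearMap.ker A) : Fin n → F) = 0 := (ψ c : LinearMap.ker A).2
    rw [this]; simp
  have hinj : Function.Injective φ := by
    rw [injective_iff_map_eq_zero]
    rintro ⟨a, b, c⟩ h
    have ha : a = 0 := by
      have := hAφ a b c
      rw [h, map_zero] at this
      exact (smul_eq_zero.1 this.symm).resolve_right hu
    subst ha
    rw [hφ, zero_smul, zero_add] at h
    have h' : b • v + (ψ c : LinearMap.ker A) = 0 := Subtype.ext h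
    have hm : b • v ∈ W := by
      rw [eq_neg_of_add_eq_zero_left h']
      exact W.neg_mem (ψ c).2
    have hb := Submodule.disjoint_def.1 hW.disjoint _ (Submodule.smul_mem _ _ (Submodule.mem_span_singleton_self v)) hm
    rw [hb, zero_add] at h'
    have hc : ψ c = 0 := Subtype.ext h'
    rw [(smul_eq_zero.1 hb).resolve_right hv, ψ.map_eq_zero_iff.1 hc]
    rfl
  refine ⟨LinearEquiv.ofInjectiveOfFinrankEq φ hinj (by simp; omega), ?_⟩
  rintro ⟨a, b, c⟩
  show A (φ (a, b, c)) = φ (0, a, 0)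
  rw [hAφ, hφ]; simp

lemma transv_conj {F : Type*} [Field F] {n : ℕ} (hn : 2 ≤ n)
    (t t' : Matrix.SpecialLinearGroup (Fin n) F) (ht : IsTransvection t) (ht' : IsTransvection t') :
    ∃ h : Matrix.SpecialLinearGroup (Fin n) F →* Matrix.SpecialLinearGroup (Fin n) F, h t = t' := by
  have key : ∀ s : Matrix.SpecialLinearGroup (Fin n) F, IsTransvection s →
      ∃ φ : (F × F × (Fin (n - 2) → F)) ≃ₗ[F] (Fin n → F), ∀ x,
      Matrix.toLin' ((s : Matrix (Fin n) (Fin n) F) - 1) (φ x) = φ (0, x.1, 0) := by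
    intro s hs
    refine normalForm hn _ hs.2.1 fun x => ?_
    have := hs.2.2
    rw [pow_two] at this
    rw [← LinearMap.comp_apply, ← Matrix.toLin'_mul, this]; simp
  obtain ⟨φ, hφ⟩ := key t ht
  obtain ⟨φ', hφ'⟩ := key t' ht'
  let H : (Fin n → F) ≃ₗ[F] (Fin n → F) := φ.symm.trans φ'
  let M := LinearMap.toMatrix' H.toLinearMap
  let M' := LinearMap.toMatrix' H.symm.toLinearMap
  have hMM' : M * M' = 1 := by
    rw [← LinearMap.toMatrix'_comp]; simp
  have hM'M : M' * M = 1 := by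
    rw [← LinearMap.toMatrix'_comp]; simp
  have hd : M.det * M'.det = 1 := by rw [← Matrix.det_mul, hMM', Matrix.det_one]
  let h : Matrix.SpecialLinearGroup (Fin n) F →* Matrix.SpecialLinearGroup (Fin n) F :=
    { toFun := fun x => ⟨M * x * M', by
        rw [Matrix.det_mul, Matrix.det_mul, x.2, mul_one, hd]⟩
      map_one' := Subtype.ext (by simp [hMM'])
      map_mul' := fun x y => Subtype.ext (by
        show M * (x.1 * y.1) * M' = (M * x.1 * M') * (M * y.1 * M')
        calc M * (x.1 * y.1) * M' = M * x.1 * 1 * y.1 * M' := by simp [mul_assoc]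
          _ = _ := by rw [← hM'M]; simp only [mul_assoc]) }
  refine ⟨h, Subtype.ext ?_⟩
  show M * (t : Matrix (Fin n) (Fin n) F) * M' = t'
  have e : M * ((t : Matrix (Fin n) (Fin n) F) - 1) = (t' - 1) * M := by
    apply Matrix.toLin'.injective
    rw [Matrix.toLin'_mul, Matrix.toLin'_mul, Matrix.toLin'_toMatrix']
    refine LinearMap.ext fun x => ?_
    obtain ⟨y, rfl⟩ := φ.surjective x
    simp only [LinearMap.comp_apply, hφ]
    simp [H]
    have := hφ' y
    simpa using this.symm
  have e2 : M * (t : Matrix (Fin n) (Fin n) F) = t' * M := by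
    rw [mul_sub, sub_mul, mul_one, one_mul] at e
    exact sub_left_injective e
  rw [e2, mul_assoc, hMM', mul_one]

lemma transv_inv {F : Type*} [Field F] {n : ℕ}
    (t : Matrix.SpecialLinearGroup (Fin n) F) (ht : IsTransvection t) : IsTransvection t⁻¹ := by
  have h2 := ht.2.2
  have e : ((t⁻¹ : Matrix.SpecialLinearGroup (Fin n) F) : Matrix (Fin n) (Fin n) F) - 1 = -((t : Matrix (Fin n) (Fin n) F) - 1) := by
    have h3 : (((t⁻¹ : Matrix.SpecialLinearGroup (Fin n) F)) : Matrix (Fin n) (Fin n) F) * t = 1 := by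
      rw [← Matrix.SpecialLinearGroup.coe_mul]; simp
    have h4 : (t : Matrix (Fin n) (Fin n) F) * (2 - t) = 1 := by
      rw [pow_two] at h2
      have : (t : Matrix (Fin n) (Fin n) F) * (2 - t) = 1 - (t - 1) * (t - 1) := by noncomm_ring
      rw [this, h2, sub_zero]
    have := left_inv_eq_right_inv h3 h4
    rw [this, ← one_add_one_eq_two]
    abel
  refine ⟨by simpa using ht.1, ?_, ?_⟩
  · rw [e]
    have := ht.2.1
    rw [Matrix.rank, show (-((t : Matrix (Fin n) (Fin n) F) - 1)).mulVecLin =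
      -((t : Matrix (Fin n) (Fin n) F) - 1).mulVecLin from map_neg (Matrix.toLin') _,
      LinearMap.range_neg]
    exact this
  · rw [e, neg_sq, h2]

lemma final_of_word {F : Type*} [Field F] {n : ℕ} (hn : 2 ≤ n) (w : FreeGroup (Fin 2))
    (h1 : ∀ f : Fin 2 → Matrix.SpecialLinearGroup (Fin n) F,
      FreeGroup.lift f w = 1 ∨ IsTransvection (FreeGroup.lift f w))
    (h2 : ∃ f : Fin 2 → Matrix.SpecialLinearGroup (Fin n) F, FreeGroup.lift f w ≠ 1) :
    wordValues w (Matrix.SpecialLinearGroup (Fin n) F) =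
        {g : Matrix.SpecialLinearGroup (Fin n) F | g = 1 ∨ IsTransvection g} := by
  ext g
  constructor
  · rintro ⟨f, h | h⟩
    · rw [← h]; exact h1 f
    · have := h1 f
      rw [h] at this
      rcases this with h' | h'
      · left; simpa using h'
      · right; simpa using transv_inv _ h'
  · rintro (rfl | hg)
    · exact ⟨fun _ => 1, Or.inl (by
        have : FreeGroup.lift (fun _ : Fin 2 => (1 : Matrix.SpecialLinearGroup (Fin n) F)) = 1 := by
          ext i; simp
        rw [this]; rfl)⟩
    · obtain ⟨f, hf⟩ := h2
      obtain ⟨H, hH⟩ := transv_conj hn _ g ((h1 f).resolve_left hf) hg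
      refine ⟨fun i => H (f i), Or.inl ?_⟩
      rw [← hH]
      have : FreeGroup.lift (fun i => H (f i)) = H.comp (FreeGroup.lift f) := by
        ext i; simp
      rw [this]; rfl

lemma exists_lam {F K : Type*} [Field F] [Finite F] [Field K] [Algebra F K] [FiniteDimensional F K]
    (p : ℕ) [Fact p.Prime] [CharP F p] (k s : ℕ)
    (hk : ¬ (Nat.card F ^ finrank F K - 1 ∣ k * (Nat.card F - 1))) :
    ∃ l : K, l ≠ 0 ∧ (l * algebraMap F K (Algebra.norm F l)) ^ (k * p ^ s) ≠ 1 := by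
  by_contra! h
  apply hk
  have : Finite K := Module.finite_of_finite F
  have hp : p.Prime := Fact.out
  have := Fintype.ofFinite F
  have := Fintype.ofFinite K
  have hcard : Nat.card K = Nat.card F ^ finrank F K := Module.natCard_eq_pow_finrank
  obtain ⟨g, hg⟩ := IsCyclic.exists_generator (α := Kˣ)
  have ho : orderOf g = Nat.card F ^ finrank F K - 1 := by
    rw [orderOf_eq_card_of_forall_mem_zpowers hg, Nat.card_units, hcard]
  have h1 : g ^ (k * p ^ s * (Nat.card F - 1)) = 1 := by
    apply Units.ext
    rw [Units.val_pow_eq_pow_val, Units.val_one]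
    have h2 := h g g.ne_zero
    have h3 : (algebraMap F K (Algebra.norm F (g : K))) ^ (Nat.card F - 1) = 1 := by
      rw [← map_pow, Nat.card_eq_fintype_card, FiniteField.pow_card_sub_one_eq_one, map_one]
      exact Algebra.norm_ne_zero_iff.2 g.ne_zero
    have h4 := congrArg (· ^ (Nat.card F - 1)) h2
    simp only [one_pow] at h4
    rw [mul_pow, mul_pow, ← pow_mul, ← pow_mul, mul_comm (k * p ^ s) (Nat.card F - 1), pow_mul _ (Nat.card F - 1),
      pow_mul (algebraMap F K _), h3, one_pow, mul_one, ← pow_mul] at h4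
    rw [mul_comm]; exact h4
  have h2 := orderOf_dvd_of_pow_eq_one h1
  rw [ho] at h2
  have hco : Nat.Coprime (Nat.card F ^ finrank F K - 1) (p ^ s) := by
    apply Nat.Coprime.pow_right
    rw [Nat.coprime_comm, hp.coprime_iff_not_dvd]
    intro hd
    obtain ⟨a, ha, hF⟩ := FiniteField.card F p
    have h5 : p ∣ Nat.card F ^ finrank F K := by
      refine dvd_pow ?_ Module.finrank_pos.ne'
      rw [Nat.card_eq_fintype_card, hF]
      exact dvd_pow_self _ a.pos.ne'
    have h6 : 1 ≤ Nat.card F ^ finrank F K := Nat.one_le_pow _ _ Nat.card_pos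
    have := (Nat.dvd_sub h5 hd)
    rw [Nat.sub_sub_self h6] at this
    exact hp.one_lt.ne' (Nat.dvd_one.1 this)
  rw [mul_right_comm] at h2
  exact hco.dvd_of_dvd_mul_right h2

lemma construct {F K : Type*} [Field F] [Finite F] [Field K] [Algebra F K] [FiniteDimensional F K]
    (p : ℕ) [Fact p.Prime] [CharP F p] {n : ℕ} (hn : finrank F K + 1 = n) (k : ℕ) (l : K)
    (hl : l ≠ 0) (hlk : (l * algebraMap F K (Algebra.norm F l)) ^ k ≠ 1) :
    ∃ (E : Subgroup (Matrix.SpecialLinearGroup (Fin n) F)) (c e : Matrix.SpecialLinearGroup (Fin n) F),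
      IsPGroup p E ∧ (∀ x ∈ E, c * x * c⁻¹ ∈ E) ∧ e ∈ E ∧ e ^ p = 1 ∧
      ∀ y ∈ E, (y * c) ^ k * e * ((y * c) ^ k)⁻¹ * e⁻¹ ≠ 1 := by
  have hfr : finrank F (K × F) = n := by rw [finrank_prod, finrank_self, hn]
  let b : Basis (Fin n) F (K × F) := finBasisOfFinrankEq F (K × F) hfr
  let τ := LinearMap.toMatrixAlgEquiv b
  let mk : ∀ T : Module.End F (K × F), LinearMap.det T = 1 → Matrix.SpecialLinearGroup (Fin n) F :=
    fun T hT => ⟨τ T, by rw [← hT, ← LinearMap.det_toMatrix b]; rfl⟩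
  have hmk : ∀ T hT T' hT' T'' hT'', T * T' = T'' → mk T hT * mk T' hT' = mk T'' hT'' := by
    intro T hT T' hT' T'' hT'' h
    apply Subtype.ext
    show τ T * τ T' = τ T''
    rw [← map_mul, h]
  have hmki : ∀ T hT T' hT', mk T hT = mk T' hT' → T = T' := by
    intro T hT T' hT' h
    exact τ.injective (congrArg Subtype.val h)
  let t : K → Module.End F (K × F) := fun z => LinearMap.transvection (LinearMap.snd F K F) (z, 0)
  have ht : ∀ z x y, t z (x, y) = (x + y • z, y) := by
    intro z x y
    simp [t, LinearMap.transvection.apply]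
  have htd : ∀ z, LinearMap.det (t z) = 1 := by
    intro z
    rw [LinearMap.transvection.det]; simp
  have htm : ∀ z z', t z * t z' = t (z + z') := by
    intro z z'
    refine LinearMap.ext fun ⟨x, y⟩ => ?_
    rw [Module.End.mul_apply, ht, ht, ht]
    ext <;> simp
    ring
  let e : Multiplicative K →* Matrix.SpecialLinearGroup (Fin n) F :=
    MonoidHom.mk' (fun z => mk (t z.toAdd) (htd _)) (fun z z' => (hmk _ (htd _) _ (htd _) _ (htd _) (htm _ _)).symm)
  have he : ∀ z, e z = mk (t z.toAdd) (htd _) := fun z => rfl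
  have hei : Function.Injective e := by
    intro z z' h
    have h := LinearMap.congr_fun (hmki _ (htd _) _ (htd _) h) (0, 1)
    rw [ht, ht] at h
    simpa using congrArg Prod.fst h
  have hep : ∀ z, e z ^ p = 1 := by
    intro z
    have : z ^ p = 1 := by
      apply Multiplicative.toAdd.injective
      rw [toAdd_pow, toAdd_one, ← Nat.cast_smul_eq_nsmul F, CharP.cast_eq_zero, zero_smul]
    rw [← map_pow, this, map_one]
  set N := Algebra.norm F l with hN
  have hN0 : N ≠ 0 := Algebra.norm_ne_zero_iff.2 hl
  set ν := l * algebraMap F K N with hν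
  let T : Module.End F (K × F) := LinearMap.prodMap (LinearMap.mulLeft F l) (LinearMap.mulLeft F N⁻¹)
  have hT : ∀ x y, T (x, y) = (l * x, N⁻¹ * y) := fun x y => rfl
  have hTd : LinearMap.det T = 1 := by
    have h1 : LinearMap.det (LinearMap.mulLeft F l) = N := rfl
    have h2 : LinearMap.det (LinearMap.mulLeft F N⁻¹) = N⁻¹ := by simp
    rw [LinearMap.det_prodMap, h1, h2, mul_inv_cancel₀ hN0]
  let c := mk T hTd
  have hce : ∀ z : K, c * e (Multiplicative.ofAdd z) = e (Multiplicative.ofAdd (ν * z)) * c := by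
    intro z
    rw [he, he]
    refine (hmk _ hTd _ (htd _) (T * t z) (by rw [map_mul, hTd, htd, one_mul]) rfl).trans
      (hmk _ (htd _) _ hTd _ (by rw [map_mul, hTd, htd, one_mul]) ?_).symm
    refine LinearMap.ext fun ⟨x, y⟩ => ?_
    simp only [Module.End.mul_apply, toAdd_ofAdd]
    rw [hT, ht, ht, hT]
    ext
    · simp only [Algebra.smul_def, hν, map_mul, map_inv₀]
      have : algebraMap F K N ≠ 0 := by simpa using hN0
      field_simp
    · rfl
  refine ⟨e.range, c, e (Multiplicative.ofAdd 1), ?_, ?_, ⟨_, rfl⟩, hep _, ?_⟩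
  · rw [isPGroup_iff_pow_pow_eq_one]
    rintro ⟨_, z, rfl⟩
    exact ⟨1, Subtype.ext (by simpa using hep z)⟩
  · rintro _ ⟨z, rfl⟩
    have := hce z.toAdd
    rw [ofAdd_toAdd] at this
    rw [this, mul_assoc, mul_inv_cancel, mul_one]
    exact ⟨_, rfl⟩
  · rintro _ ⟨z0, rfl⟩
    have h1 : ∀ j : ℕ, ∀ z : K, (e z0 * c) ^ j * e (Multiplicative.ofAdd z) =
        e (Multiplicative.ofAdd (ν ^ j * z)) * (e z0 * c) ^ j := by
      intro j
      induction j with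
      | zero => intro z; simp
      | succ j ih =>
        intro z
        rw [pow_succ', mul_assoc, ih, ← mul_assoc, mul_assoc (e z0), hce, ← mul_assoc (e z0),
          ← map_mul, mul_comm z0, map_mul, pow_succ', mul_assoc ν]
        simp only [mul_assoc]
    rw [h1, mul_inv_cancel_right]
    intro h
    rw [mul_inv_eq_one] at h
    have := hei h
    simp only [mul_one, Multiplicative.ofAdd.apply_eq_iff_eq] at this
    exact hlk this

lemma caseTwo {F : Type*} [Field F] [Finite F] (p : ℕ) [Fact p.Prime] [CharP F p] :
    ∃ w : FreeGroup (Fin 2), wordValues w (Matrix.SpecialLinearGroup (Fin 2) F) =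
        {g : Matrix.SpecialLinearGroup (Fin 2) F | g = 1 ∨ IsTransvection g} := by
  have hp : p.Prime := Fact.out
  have := Fintype.ofFinite F
  refine ⟨FreeGroup.of 0 ^ (Nat.card F ^ 2 - 1), final_of_word le_rfl _ ?_ ?_⟩
  · intro f
    simp only [map_pow, FreeGroup.lift_apply_of]
    have hs := pow_isP p two_ne_zero (Nat.card F ^ 2 - 1) (f 0) (by
      intro P hP hd
      have h1 := natDegree_le_of_dvd hd (Matrix.charpoly_monic _).ne_zero
      rw [Matrix.charpoly_natDegree_eq_dim, Fintype.card_fin] at h1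
      have h2 := hP.natDegree_pos
      apply Nat.pow_sub_one_dvd_pow_sub_one
      interval_cases P.natDegree <;> decide)
    refine isTransv_of_rank p _ ?_ (Or.inr hs)
    obtain ⟨s, hs⟩ := hs
    generalize f 0 ^ (Nat.card F ^ 2 - 1) = g at hs
    set A : Matrix (Fin 2) (Fin 2) F := (g : Matrix (Fin 2) (Fin 2) F)
    have hnil : (Matrix.toLin' A - 1) ^ p ^ s = 0 := by
      have h1 : A ^ p ^ s = 1 := by
        simpa using congrArg Subtype.val hs
      have h2 : (A - 1) ^ p ^ s = 0 := by
        rw [sub_pow_char_pow_of_commute _ _ (Commute.one_right _), h1]; simp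
      have : Matrix.toLin' A - 1 = Matrix.toLin' (A - 1) := by
        rw [map_sub, Matrix.toLin'_one]; rfl
      rw [this, ← Matrix.toLin'_pow, h2, map_zero]
    have hk := (Matrix.toLin' A - 1).finrank_range_add_finrank_ker
    rw [finrank_fin_fun] at hk
    have hker : finrank F (LinearMap.ker (Matrix.toLin' A - 1)) ≠ 0 := by
      intro h
      rw [Submodule.finrank_eq_zero, LinearMap.ker_eq_bot] at h
      have h3 : Function.Injective ⇑((Matrix.toLin' A - 1 : Module.End F (Fin 2 → F)) ^ p ^ s) := by
        rw [Module.End.coe_pow]; exact h.iterate _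
      rw [hnil] at h3
      obtain ⟨x, y, hxy⟩ := exists_pair_ne (Fin 2 → F)
      exact hxy (h3 rfl)
    omega
  · let t : Matrix.SpecialLinearGroup (Fin 2) F := ⟨!![1, 1; 0, 1], by simp⟩
    refine ⟨fun _ => t, ?_⟩
    simp only [map_pow, FreeGroup.lift_apply_of]
    intro h
    have htp : t ^ p = 1 := by
      have h2 : ((t : Matrix (Fin 2) (Fin 2) F) - 1) ^ 2 = 0 := by
        rw [pow_two]
        ext i j
        fin_cases i <;> fin_cases j <;> simp [t, Matrix.mul_apply, Fin.sum_univ_two]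
      have h3 : ((t : Matrix (Fin 2) (Fin 2) F) - 1) ^ p = 0 := pow_eq_zero_of_le hp.two_le h2
      rw [sub_pow_char_of_commute _ (Commute.one_right _), one_pow, sub_eq_zero] at h3
      exact Subtype.ext (by simpa using h3)
    obtain ⟨a, ha, hF⟩ := FiniteField.card F p
    have h5 : t ^ (Nat.card F ^ 2) = 1 := by
      apply orderOf_dvd_iff_pow_eq_one.1
      refine (orderOf_dvd_of_pow_eq_one htp).trans ?_
      refine dvd_pow ?_ two_ne_zero
      rw [Nat.card_eq_fintype_card, hF]
      exact dvd_pow_self _ a.pos.ne'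
    have h6 : 1 ≤ Nat.card F ^ 2 := Nat.one_le_pow _ _ Nat.card_pos
    rw [← Nat.sub_add_cancel h6, pow_succ, h, one_mul] at h5
    have := congrArg (fun x : Matrix.SpecialLinearGroup (Fin 2) F => (x : Matrix (Fin 2) (Fin 2) F) 0 1) h5
    simp [t] at this

lemma caseThree {F : Type*} [Field F] [Finite F] (p : ℕ) [Fact p.Prime] [CharP F p] {n : ℕ}
    (hn : 3 ≤ n) :
    ∃ w : FreeGroup (Fin 2), wordValues w (Matrix.SpecialLinearGroup (Fin n) F) =
        {g : Matrix.SpecialLinearGroup (Fin n) F | g = 1 ∨ IsTransvection g} := by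
  obtain ⟨k, hk0, hk, hnk⟩ := arith (Nat.card F) n Finite.one_lt_card hn
  have : NeZero (n - 1) := ⟨by omega⟩
  let K := FiniteField.Extension F p (n - 1)
  have hK : finrank F K = n - 1 := FiniteField.finrank_extension F p (n - 1)
  have : FiniteDimensional F K := FiniteDimensional.of_finrank_pos (by omega)
  set s := Nat.card (Matrix.SpecialLinearGroup (Fin n) F) with hs
  obtain ⟨l, hl, hlk⟩ := exists_lam (F := F) (K := K) p k s (by rw [hK]; exact hnk)
  obtain ⟨E, c, e, hE, hc, he, hep, hne⟩ := construct p (n := n) (by omega) (k * p ^ s) l hl hlk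
  obtain ⟨w, hw, hw'⟩ := wordLemma p (k * p ^ s) {g | g = 1 ∨ IsTransvection g} (Or.inl rfl)
    (fun a => hS_holds p hn k hk a) E hE c e hc he hep hne
  exact ⟨w, final_of_word (by omega) w hw hw'⟩

end Helpers

theorem stmt14 (n : ℕ) (hn : 2 ≤ n) (F : Type) [Field F] [Fintype F]
    (q : ℕ) (hq : Fintype.card F = q) (h : ¬(n = 4 ∧ q = 2)) :
    ∃ w : FreeGroup (Fin 2),
      wordValues w (Matrix.SpecialLinearGroup (Fin n) F) =
        {g : Matrix.SpecialLinearGroup (Fin n) F | g = 1 ∨ IsTransvection g} := by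
  obtain ⟨p, hp⟩ := CharP.exists F
  have : Fact p.Prime := ⟨CharP.char_is_prime F p⟩
  rcases Nat.lt_or_ge n 3 with h3 | h3
  · obtain rfl : n = 2 := by omega
    exact caseTwo p
  · exact caseThree p h3
end

section
/- Let F be a finite field of cardinality q and let n ≥ 2 be a natural number with n ∉ {3,4}, or n = 3 and q ∉ {2,4}. Then there exist positive integers A and B such that for every x ∈ SL_n(F), if x^A ≠ 1 and x^B ≠ 1 then x^B is a transvection in SL_n(F); moreover there exists x ∈ SL_n(F) with x^A ≠ 1 and x^B ≠ 1. -/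
open Polynomial

lemma gcd_lcm_dvd_s16 (a b G K : ℕ) (ha : Nat.gcd a G ∣ K) (hb : Nat.gcd b G ∣ K) : Nat.gcd (Nat.lcm a b) G ∣ K := by
  rcases eq_or_ne a 0 with rfl | ha0
  · simpa using ha
  rcases eq_or_ne b 0 with rfl | hb0
  · simpa using hb
  rw [Nat.dvd_iff_prime_pow_dvd_dvd]
  intro p k hp hk
  have h1 := hk.trans (Nat.gcd_dvd_left _ _)
  have h2 := hk.trans (Nat.gcd_dvd_right _ _)
  rw [hp.pow_dvd_iff_le_factorization (Nat.lcm_ne_zero ha0 hb0), Nat.factorization_lcm ha0 hb0,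
    Finsupp.sup_apply, le_sup_iff, ← hp.pow_dvd_iff_le_factorization ha0,
    ← hp.pow_dvd_iff_le_factorization hb0] at h1
  rcases h1 with h1 | h1
  · exact (Nat.dvd_gcd h1 h2).trans ha
  · exact (Nat.dvd_gcd h1 h2).trans hb

lemma num (q m : ℕ) (hq : 2 ≤ q) (hm : 2 ≤ m) :
    ¬ (q^m - 1 ∣ (q-1) * (Finset.Icc 1 (m-1)).lcm (fun i => q^i-1)) := by
  intro hd
  have h1 := sub_one_lt_natAbs_cyclotomic_eval (n := m) (q := q) (by omega) (by omega)
  set c := ((cyclotomic m ℤ).eval (q:ℤ)).natAbs with hc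
  have key : ∀ d ∈ m.properDivisors, (q^d-1) * c ∣ q^m-1 := by
    intro d hd
    have := map_dvd (evalRingHom (q:ℤ)) (X_pow_sub_one_mul_cyclotomic_dvd_X_pow_sub_one_of_dvd ℤ hd)
    simp only [map_mul, map_sub, map_pow, coe_evalRingHom, eval_X, map_one] at this
    have := Int.natAbs_dvd_natAbs.2 this
    rw [Int.natAbs_mul] at this
    have e : ∀ i : ℕ, ((q:ℤ)^i-1).natAbs = q^i-1 := by
      intro i
      have : 1 ≤ q^i := Nat.one_le_pow _ _ (by omega)
      zify [this]
      rw [abs_of_nonneg]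
      have : (1:ℤ) ≤ q^i := by exact_mod_cast this
      linarith
    rwa [e, e] at this
  have hG : 0 < q^m-1 := by
    have := Nat.one_lt_pow (n := m) (a := q) (by omega) (by omega)
    omega
  obtain ⟨K, hK⟩ : c ∣ q^m-1 := (Dvd.intro_left _ rfl).trans (key 1 (by simp; omega))
  have hc0 : 0 < c := by omega
  have hK0 : 0 < K := by
    rcases Nat.eq_zero_or_pos K with h | h
    · simp [h] at hK; omega
    · exact h
  have h2 : Nat.gcd ((Finset.Icc 1 (m-1)).lcm (fun i => q^i-1)) (q^m-1) ∣ K := by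
    have : ∀ s : Finset ℕ, (∀ i ∈ s, 1 ≤ i ∧ i < m) → Nat.gcd (s.lcm (fun i => q^i-1)) (q^m-1) ∣ K := by
      intro s
      induction s using Finset.induction_on with
      | empty => simp
      | insert i s hi ih =>
        intro hs
        rw [Finset.lcm_insert]
        refine gcd_lcm_dvd_s16 _ _ _ _ ?_ (ih fun j hj => hs j (Finset.mem_insert_of_mem hj))
        rw [Nat.pow_sub_one_gcd_pow_sub_one]
        have := hs i (Finset.mem_insert_self _ _)
        have := key (Nat.gcd i m) (by
          rw [Nat.mem_properDivisors]
          exact ⟨Nat.gcd_dvd_right _ _, (Nat.gcd_le_left _ (by omega)).trans_lt this.2⟩)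
        rw [hK, mul_comm] at this
        exact Nat.dvd_of_mul_dvd_mul_left hc0 this
    apply this
    intro i hi
    simp at hi
    omega
  have h3 : q^m-1 ∣ (q-1) * K := by
    refine dvd_trans ?_ (mul_dvd_mul_left (q-1) h2)
    rw [← Nat.gcd_mul_left]
    exact Nat.dvd_gcd hd (Dvd.intro_left _ rfl)
  rw [hK] at h3
  have := Nat.le_of_dvd (by omega) (Nat.dvd_of_mul_dvd_mul_right hK0 h3)
  omega

lemma core {n : ℕ} {F : Type} [Field F] (M : Matrix (Fin n) (Fin n) F) (a : F) (g : F[X])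
    (hχ : M.charpoly = (X - C a)^2*g) (hg : g.eval a ≠ 0) (B : ℕ)
    (hd : (X - C a)*g ∣ X^B-1) (h1 : M^B ≠ 1) :
    (M^B-1).rank = 1 ∧ (M^B-1)^2 = 0 := by
  have e1 : ∀ P : F[X], (M.charpoly ∣ P) → aeval M P = 0 := by
    rintro P ⟨k, rfl⟩
    simp [Matrix.aeval_self_charpoly]
  refine ⟨?_, ?_⟩
  swap
  · have := e1 ((X^B-1)^2) (by
      rw [hχ]
      refine dvd_trans ?_ (pow_dvd_pow_of_dvd hd 2)
      exact ⟨g, by ring⟩)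
    simpa using this
  obtain ⟨k, hk⟩ := hd
  have hM : M^B-1 = aeval M (X - C a) * aeval M (g*k) := by
    rw [← map_mul, ← mul_assoc, ← hk]; simp
  set φ : Module.End F (Fin n → F) := Matrix.toLin' M with hφ
  have hE : Module.finrank F (φ.maxGenEigenspace a) = 2 := by
    rw [LinearMap.finrank_maxGenEigenspace_eq, Matrix.charpoly_toLin', hχ]
    have hg0 : g ≠ 0 := by rintro rfl; simp at hg
    rw [rootMultiplicity_mul (mul_ne_zero (pow_ne_zero _ (X_sub_C_ne_zero a)) hg0),
      rootMultiplicity_X_sub_C_pow, rootMultiplicity_eq_zero hg]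
  have hX : aeval M (X - C a) = M - a • 1 := by
    simp [Algebra.algebraMap_eq_smul_one]
  have hz : (M - a•1)*((M - a•1) * aeval M (g*k)) = 0 := by
    rw [← hX, ← map_mul, ← map_mul]
    apply e1
    rw [hχ]
    exact ⟨k, by ring⟩
  rw [hX] at hM
  have hmem : ∀ v, v ∈ φ.eigenspace a ↔ (M - a • 1).mulVec v = 0 := by
    intro v
    rw [Module.End.mem_eigenspace_iff, hφ, Matrix.toLin'_apply, Matrix.sub_mulVec, sub_eq_zero,
      Matrix.smul_mulVec, Matrix.one_mulVec]
  have hle : φ.eigenspace a ≤ φ.maxGenEigenspace a := Module.End.genEigenspace_le_maximal φ a 1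
  have hmem2 : ∀ v, (M - a • 1).mulVec ((M - a • 1).mulVec v) = 0 → v ∈ φ.maxGenEigenspace a := by
    intro v hv
    rw [Module.End.mem_maxGenEigenspace]
    refine ⟨2, ?_⟩
    have : φ - a • 1 = Matrix.toLin' (M - a•1) := by simp [hφ]; rfl
    rw [this, pow_two, Module.End.mul_apply, Matrix.toLin'_apply, Matrix.toLin'_apply, hv]
  have hne : φ.eigenspace a ≠ φ.maxGenEigenspace a := by
    intro heq
    apply h1
    rw [← sub_eq_zero, hM]
    apply Matrix.toLin'.injective
    ext1 i
    ext1
    rw [LinearMap.comp_apply, Matrix.toLin'_apply, ← Matrix.mulVec_mulVec, (hmem _).1]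
    · simp
    · rw [heq]
      apply hmem2
      rw [Matrix.mulVec_mulVec, Matrix.mulVec_mulVec, Matrix.mul_assoc, hz,
        Matrix.zero_mulVec]
  have hlt := Submodule.finrank_lt_finrank_of_lt (lt_of_le_of_ne hle hne)
  have hr : (M^B-1).rank ≤ Module.finrank F (φ.eigenspace a) := by
    rw [Matrix.rank]
    apply Submodule.finrank_mono
    rintro _ ⟨v, rfl⟩
    rw [hmem, Matrix.mulVecLin_apply, Matrix.mulVec_mulVec, hM, hz]
    simp
  have h0 : (M^B-1).rank ≠ 0 := by
    intro h0
    apply h1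
    rw [← sub_eq_zero]
    rw [Matrix.rank, Submodule.finrank_eq_zero, LinearMap.range_eq_bot] at h0
    apply Matrix.toLin'.injective
    rw [← Matrix.toLin'_apply'] at h0
    simpa using h0
  omega

lemma dvd_pow_deg {F : Type} [Field F] (χ h : F[X]) (h0 : χ ≠ 0)
    (H : ∀ f, Irreducible f → f ∣ χ → f ∣ h) : χ ∣ h ^ χ.natDegree := by
  classical
  have h1 := UniqueFactorizationMonoid.prod_normalizedFactors h0
  have hdeg : (UniqueFactorizationMonoid.normalizedFactors χ).card ≤ χ.natDegree := by
    rw [← natDegree_eq_of_degree_eq (degree_eq_degree_of_associated h1),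
      natDegree_multiset_prod _ (by
        intro hh; exact UniqueFactorizationMonoid.zero_notMem_normalizedFactors χ hh)]
    have := Multiset.card_nsmul_le_sum (s := (UniqueFactorizationMonoid.normalizedFactors χ).map natDegree) (a := 1) (by
      intro x hx
      obtain ⟨f, hf, rfl⟩ := Multiset.mem_map.1 hx
      exact (UniqueFactorizationMonoid.irreducible_of_normalized_factor f hf).natDegree_pos)
    simpa using this
  refine h1.symm.dvd.trans (dvd_trans ?_ (pow_dvd_pow h hdeg))
  have : ∀ s : Multiset F[X], (∀ f ∈ s, f ∣ h) → s.prod ∣ h ^ s.card := by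
    intro s
    induction s using Multiset.induction_on with
    | empty => simp
    | cons f s ih =>
      intro hs
      rw [Multiset.prod_cons, Multiset.card_cons, pow_succ']
      exact mul_dvd_mul (hs f (Multiset.mem_cons_self f s)) (ih fun g hg => hs g (Multiset.mem_cons_of_mem hg))
  apply this
  intro f hf
  exact H f (UniqueFactorizationMonoid.irreducible_of_normalized_factor f hf)
    (UniqueFactorizationMonoid.dvd_of_mem_normalizedFactors hf)

lemma irr_dvd {F : Type} [Field F] [Fintype F] {n : ℕ} (M : Matrix (Fin n) (Fin n) F) (hM : M.det = 1)
    (f : F[X]) (hf : Irreducible f) (hd : f ∣ M.charpoly) :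
    f ∣ X ^ (Fintype.card F ^ f.natDegree - 1) - 1 := by
  have h1 := (hf.natDegree_dvd_iff_dvd_X_pow_card_pow_sub_X).1 dvd_rfl
  rw [Nat.card_eq_fintype_card] at h1
  have hq : 0 < Fintype.card F ^ f.natDegree := pow_pos Fintype.card_pos _
  have e : (X ^ (Fintype.card F ^ f.natDegree) - X : F[X]) = X * (X ^ (Fintype.card F ^ f.natDegree - 1) - 1) := by
    rw [mul_sub, ← pow_succ', Nat.sub_add_cancel hq, mul_one]
  rw [e] at h1
  rcases hf.prime.dvd_or_dvd h1 with h | h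
  · exfalso
    have : (X : F[X]) ∣ M.charpoly := ((hf.associated_of_dvd irreducible_X h).dvd_iff_dvd_left).1 hd
    rw [X_dvd_iff] at this
    rw [Matrix.det_eq_sign_charpoly_coeff, this] at hM
    simp at hM
  · exact h

lemma pow_dvd_X {F : Type} [Field F] (f : F[X]) (a b : ℕ) (hab : a ∣ b) (h : f ∣ X^a-1) : f ∣ X^b-1 := by
  obtain ⟨c, rfl⟩ := hab
  refine h.trans ?_
  rw [pow_mul]
  exact sub_one_dvd_pow_sub_one _ _

lemma kill {F : Type} [Field F] {p : ℕ} [Fact p.Prime] [CharP F p] {n : ℕ} (M : Matrix (Fin n) (Fin n) F)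
    (L : ℕ) (H : ∀ f, Irreducible f → f ∣ M.charpoly → f ∣ X^L-1) : M ^ (L * p^n) = 1 := by
  have h1 := dvd_pow_deg _ _ M.charpoly_monic.ne_zero H
  rw [M.charpoly_natDegree_eq_dim, Fintype.card_fin] at h1
  have h2 := h1.trans (pow_dvd_pow _ (Nat.lt_pow_self (Fact.out : p.Prime).one_lt).le)
  rw [sub_pow_char_pow, one_pow, ← pow_mul] at h2
  obtain ⟨k, hk⟩ := h2
  have := congrArg (aeval M) hk
  simp [Matrix.aeval_self_charpoly] at this
  exact sub_eq_zero.1 this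

lemma ss {F : Type} [Field F] {n : ℕ} (M : Matrix (Fin n) (Fin n) F)
    (L : ℕ) (H : ∀ f, Irreducible f → f ∣ M.charpoly → f ∣ X^L-1) (h : M^L ≠ 1) :
    ∃ f, Irreducible f ∧ f * f ∣ M.charpoly := by
  by_contra! hc
  have h1 := dvd_pow_deg _ _ M.charpoly_monic.ne_zero H
  have h2 := (squarefree_iff_irreducible_sq_not_dvd_of_ne_zero M.charpoly_monic.ne_zero).2 hc
  obtain ⟨k, hk⟩ := h2.isRadical _ _ h1
  have := congrArg (aeval M) hk
  simp [Matrix.aeval_self_charpoly] at this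
  exact h (sub_eq_zero.1 this)

lemma ex {F : Type} [Field F] (m : ℕ) (a : F) (Y : Matrix (Fin m) (Fin m) F) (h : a^2 * Y.det = 1) :
    ∃ x : Matrix.SpecialLinearGroup (Fin (2+m)) F, ∀ k : ℕ, x^k = 1 → (k:F) = 0 ∧ a^k = 1 ∧ Y^k = 1 := by
  have ha : a ≠ 0 := by rintro rfl; simp at h
  let Z := Matrix.fromBlocks !![a, a; 0, a] 0 0 Y
  refine ⟨⟨Matrix.reindexAlgEquiv F F finSumFinEquiv Z, ?_⟩, ?_⟩
  · simp [Z, Matrix.det_fin_two, ← h, pow_two]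
  · intro k hk
    have h1 : (Matrix.reindexAlgEquiv F F finSumFinEquiv Z) ^ k = 1 :=
      (Matrix.SpecialLinearGroup.coe_pow _ k).symm.trans (congrArg Subtype.val hk)
    rw [← map_pow, ← map_one (Matrix.reindexAlgEquiv F F (finSumFinEquiv (m := 2) (n := m)))] at h1
    have h2 := (Matrix.reindexAlgEquiv F F (finSumFinEquiv (m := 2) (n := m))).injective h1
    rw [Matrix.fromBlocks_diagonal_pow, ← Matrix.fromBlocks_one, Matrix.fromBlocks_inj] at h2
    have hJ : ∀ k : ℕ, (!![a, a; 0, a])^k = !![a^k, k*a^k; 0, a^k] := by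
      intro k
      induction k with
      | zero => simp [Matrix.one_fin_two]
      | succ k ih =>
        rw [pow_succ, ih]
        rw [Matrix.mul_fin_two]
        push_cast
        congr! 4 <;> ring_nf
    obtain ⟨h3, -, -, h4⟩ := h2
    rw [hJ, Matrix.one_fin_two] at h3
    have h5 := congrFun (congrFun h3 0) 1
    have h6 := congrFun (congrFun h3 0) 0
    simp at h5 h6
    refine ⟨?_, h6, h4⟩
    rcases h5 with h5 | h5
    · exact h5
    · exact absurd h5.1 ha

lemma exY (F : Type) [Field F] [Fintype F] (p : ℕ) [Fact p.Prime] [CharP F p] (m : ℕ) [NeZero m] :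
    ∃ Y : Matrix (Fin m) (Fin m) F, Y.det = 1 ∧ ∀ L N : ℕ, Y^(L * p^N) = 1 →
      Fintype.card F ^ m - 1 ∣ (Fintype.card F - 1) * L := by
  let E := FiniteField.Extension F p m
  have : Fintype E := Fintype.ofFinite E
  have hE : Fintype.card E = Fintype.card F ^ m := by
    rw [← Nat.card_eq_fintype_card, ← Nat.card_eq_fintype_card]; exact FiniteField.natCard_extension F p m
  have : CharP E p := charP_of_injective_algebraMap (algebraMap F E).injective p
  obtain ⟨θ, hθ⟩ := IsCyclic.exists_generator (α := Eˣ)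
  let b := Module.finBasisOfFinrankEq F E (FiniteField.finrank_extension F p m)
  refine ⟨Algebra.leftMulMatrix b ((θ:E)^(Fintype.card F - 1)), ?_, ?_⟩
  · rw [← Algebra.norm_eq_matrix_det, map_pow]
    apply FiniteField.pow_card_sub_one_eq_one
    exact Algebra.norm_ne_zero_iff.2 θ.ne_zero
  · intro L N h
    rw [← map_pow, ← map_one (Algebra.leftMulMatrix b)] at h
    have h1 := Algebra.leftMulMatrix_injective b h
    rw [pow_mul] at h1
    have h2 : ((θ:E)^(Fintype.card F - 1))^L = 1 := by
      rw [← sub_eq_zero] at h1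
      have h1' := sub_pow_char_pow (((θ:E)^(Fintype.card F - 1))^L) 1 N (p := p)
      rw [one_pow, h1] at h1'
      exact sub_eq_zero.1 (pow_eq_zero_iff (pow_ne_zero _ (Fact.out : p.Prime).ne_zero) |>.1 h1')
    rw [← pow_mul] at h2
    have h3 : θ^((Fintype.card F - 1)*L) = 1 := by ext; simpa using h2
    have := orderOf_dvd_of_pow_eq_one h3
    rwa [orderOf_eq_card_of_forall_mem_zpowers hθ, Nat.card_units, Nat.card_eq_fintype_card, hE] at this

lemma fin_core {F : Type} [Field F] {n : ℕ} (x : Matrix.SpecialLinearGroup (Fin n) F) (a : F) (g : F[X])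
    (B : ℕ) (hB : ∀ f, Irreducible f → f ∣ (x : Matrix (Fin n) (Fin n) F).charpoly → f ∣ X^B-1)
    (hχ : (x : Matrix (Fin n) (Fin n) F).charpoly = (X - C a)^2*g) (hg : g.eval a ≠ 0)
    (hgB : g ∣ X^B-1) (h1 : x^B ≠ 1) : IsTransvection (x^B) := by
  have h2 : (x : Matrix (Fin n) (Fin n) F)^B ≠ 1 := by
    intro h
    apply h1
    ext1
    rw [Matrix.SpecialLinearGroup.coe_pow, h, Matrix.SpecialLinearGroup.coe_one]
  refine ⟨h1, ?_⟩
  rw [Matrix.SpecialLinearGroup.coe_pow]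
  refine core _ a g hχ hg B ?_ h2
  refine IsCoprime.mul_dvd ?_ (hB _ (irreducible_X_sub_C a) (hχ ▸ ⟨(X - C a)*g, by ring⟩)) hgB
  rw [(irreducible_X_sub_C a).coprime_iff_not_dvd, dvd_iff_isRoot]
  exact hg

lemma deg_one_sq {F : Type} [Field F] (χ f : F[X]) (hf : Irreducible f) (hd : f * f ∣ χ)
    (h1 : f.natDegree = 1) : ∃ a g, χ = (X - C a)^2 * g := by
  obtain ⟨a, ha⟩ := exists_root_of_degree_eq_one (degree_eq_iff_natDegree_eq_of_pos (by norm_num) |>.2 h1)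
  refine ⟨a, ?_⟩
  have h := dvd_iff_isRoot.2 ha
  obtain ⟨g, hg⟩ := (mul_dvd_mul h h).trans hd
  exact ⟨g, by rw [hg, pow_two]⟩

lemma sl_pow {F : Type} [Field F] {n : ℕ} (x : Matrix.SpecialLinearGroup (Fin n) F) (k : ℕ) :
    x^k = 1 ↔ (x : Matrix (Fin n) (Fin n) F)^k = 1 := by
  rw [← Matrix.SpecialLinearGroup.coe_pow, ← Matrix.SpecialLinearGroup.coe_one]
  exact Subtype.ext_iff

theorem stmt16 (F : Type) [Field F] [Fintype F] (q : ℕ) (hq : Fintype.card F = q)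
    (n : ℕ) (hn : 2 ≤ n)
    (h : (n ≠ 3 ∧ n ≠ 4) ∨ (n = 3 ∧ q ≠ 2 ∧ q ≠ 4)) :
    ∃ A B : ℕ, 0 < A ∧ 0 < B ∧
      (∀ x : Matrix.SpecialLinearGroup (Fin n) F,
        x ^ A ≠ 1 → x ^ B ≠ 1 → IsTransvection (x ^ B)) ∧
      ∃ x : Matrix.SpecialLinearGroup (Fin n) F, x ^ A ≠ 1 ∧ x ^ B ≠ 1 := by
  classical
  obtain ⟨p, hp⟩ := CharP.exists F
  have hpp : Fact p.Prime := ⟨CharP.char_is_prime F p⟩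
  have hq2 : 2 ≤ q := hq ▸ Fintype.one_lt_card
  have hpos : ∀ i ∈ Finset.Icc 1 n, 0 < q^i-1 := by
    intro i hi
    have := Nat.one_lt_pow (n := i) (a := q) (by simp at hi; omega) (by omega)
    omega
  have hppos : ∀ k, 0 < p^k := fun k => pow_pos hpp.out.pos k
  obtain ⟨B, hBdef⟩ : ∃ B, B = ∏ i ∈ Finset.Icc 1 n, (q^i-1) := ⟨_, rfl⟩
  have hB0 : 0 < B := hBdef ▸ Finset.prod_pos hpos
  have hBF : (B:F) ≠ 0 := by
    rw [hBdef, Nat.cast_prod]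
    refine Finset.prod_ne_zero_iff.2 fun i hi => ?_
    have := hpos i hi
    rw [Nat.cast_sub (by omega), Nat.cast_pow, ← hq, FiniteField.cast_card_eq_zero, zero_pow (by simp at hi; omega)]
    simp
  have hBall : ∀ x : Matrix.SpecialLinearGroup (Fin n) F, ∀ f, Irreducible f →
      f ∣ (x : Matrix (Fin n) (Fin n) F).charpoly → f ∣ X^B-1 := by
    intro x f hf hd
    refine pow_dvd_X f _ _ ?_ (irr_dvd _ x.2 f hf hd)
    have := natDegree_le_of_dvd hd (Matrix.charpoly_monic _).ne_zero
    rw [Matrix.charpoly_natDegree_eq_dim, Fintype.card_fin] at this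
    rw [hBdef, hq]
    exact Finset.dvd_prod_of_mem _ (Finset.mem_Icc.2 ⟨hf.natDegree_pos, this⟩)
  have hss : ∀ x : Matrix.SpecialLinearGroup (Fin n) F, x^B ≠ 1 →
      ∃ f, Irreducible f ∧ f * f ∣ (x : Matrix (Fin n) (Fin n) F).charpoly := by
    intro x hx
    exact ss _ B (hBall x) (fun h => hx ((sl_pow _ _).2 h))
  have hdeg : ∀ x : Matrix.SpecialLinearGroup (Fin n) F, (x : Matrix (Fin n) (Fin n) F).charpoly.natDegree = n := by
    intro x; rw [Matrix.charpoly_natDegree_eq_dim, Fintype.card_fin]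
  have hgdeg : ∀ x : Matrix.SpecialLinearGroup (Fin n) F, ∀ a g,
      (x : Matrix (Fin n) (Fin n) F).charpoly = (X - C a)^2 * g → g.Monic ∧ g.natDegree + 2 = n := by
    intro x a g hg
    have hm : g.Monic := Monic.of_mul_monic_left ((monic_X_sub_C a).pow 2) (hg ▸ Matrix.charpoly_monic _)
    refine ⟨hm, ?_⟩
    rw [← hdeg x, hg, Monic.natDegree_mul ((monic_X_sub_C a).pow 2) hm, (monic_X_sub_C a).natDegree_pow]
    simp; ring
  have hff : ∀ x : Matrix.SpecialLinearGroup (Fin n) F, ∀ f : F[X], Irreducible f →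
      f * f ∣ (x : Matrix (Fin n) (Fin n) F).charpoly → 2 * f.natDegree ≤ n := by
    intro x f hf hd
    have := natDegree_le_of_dvd hd (Matrix.charpoly_monic _).ne_zero
    rw [hdeg, natDegree_mul hf.ne_zero hf.ne_zero] at this
    omega
  by_cases hn2 : n = 2
  · subst hn2
    refine ⟨1, B, one_pos, hB0, ?_, ?_⟩
    · intro x _ hx
      obtain ⟨f, hf, hd⟩ := hss x hx
      have h1 : f.natDegree = 1 := by
        have := hff x f hf hd
        have := hf.natDegree_pos
        omega
      obtain ⟨a, g, hg⟩ := deg_one_sq _ f hf hd h1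
      obtain ⟨hm, hgd⟩ := hgdeg x a g hg
      have : g = 1 := hm.natDegree_eq_zero.1 (by omega)
      subst this
      exact fin_core x a 1 B (hBall x) hg (by simp) (one_dvd _) hx
    · obtain ⟨x, hx⟩ := ex 0 (1:F) 1 (by simp)
      refine ⟨x, fun h => ?_, fun h => hBF (hx _ h).1⟩
      have := (hx _ h).1
      simp at this
  by_cases hn3 : n = 3
  · subst hn3
    have hq' : q ≠ 2 ∧ q ≠ 4 := by omega
    refine ⟨3 * p^3, B, Nat.mul_pos (by norm_num) (hppos _), hB0, ?_, ?_⟩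
    · intro x hA hx
      obtain ⟨f, hf, hd⟩ := hss x hx
      have h1 : f.natDegree = 1 := by
        have := hff x f hf hd
        have := hf.natDegree_pos
        omega
      obtain ⟨a, g, hg⟩ := deg_one_sq _ f hf hd h1
      obtain ⟨hm, hgd⟩ := hgdeg x a g hg
      have hgi : Irreducible g := irreducible_of_degree_eq_one ((degree_eq_iff_natDegree_eq_of_pos (n := 1) (by norm_num)).2 (by omega))
      refine fin_core x a g B (hBall x) hg ?_ (hBall x g hgi (hg ▸ Dvd.intro_left _ rfl)) hx
      intro hev
      have hga : g = X - C a := by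
        refine (eq_of_monic_of_associated (monic_X_sub_C a) hm ?_).symm
        exact (irreducible_X_sub_C a).associated_of_dvd hgi (dvd_iff_isRoot.2 hev)
      rw [hga, ← pow_succ] at hg
      have ha3 : a^3 = 1 := by
        have := x.2
        rw [Matrix.det_eq_sign_charpoly_coeff, hg, coeff_zero_eq_eval_zero] at this
        simp at this
        rw [← this]; ring
      apply hA
      rw [sl_pow]
      refine kill _ 3 ?_
      intro r hr hrd
      rw [hg] at hrd
      refine (hr.prime.dvd_of_dvd_pow hrd).trans ?_
      rw [dvd_iff_isRoot]
      simp [ha3]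
    · obtain ⟨u, hu⟩ : ∃ u : Fˣ, u^3 ≠ 1 := by
        by_contra! hc
        obtain ⟨θ, hθ⟩ := IsCyclic.exists_generator (α := Fˣ)
        have := orderOf_dvd_of_pow_eq_one (hc θ)
        rw [orderOf_eq_card_of_forall_mem_zpowers hθ, Nat.card_units, Nat.card_eq_fintype_card, hq,
          Nat.dvd_prime Nat.prime_three] at this
        omega
      obtain ⟨x, hx⟩ := ex 1 (u:F) (Matrix.diagonal fun _ => ((u:F)^2)⁻¹) (by simp)
      refine ⟨x, fun h => hu ?_, fun h => hBF (hx _ h).1⟩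
      have h2 := (hx _ h).2.1
      rw [pow_mul, ← sub_eq_zero] at h2
      have h1' := sub_pow_char_pow ((u:F)^3) 1 3 (p := p)
      rw [one_pow, h2] at h1'
      ext
      simpa using sub_eq_zero.1 (pow_eq_zero_iff (hppos 3 |> fun h => by simpa using hpp.out.ne_zero) |>.1 h1')
  obtain ⟨m, rfl⟩ : ∃ m, n = 2 + m := ⟨n-2, by omega⟩
  have hm : 3 ≤ m := by omega
  obtain ⟨L, hL⟩ : ∃ L, L = (Finset.Icc 1 (m-1)).lcm (fun i => q^i-1) := ⟨_, rfl⟩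
  have hL0 : 0 < L := by
    rw [Nat.pos_iff_ne_zero, hL, Ne, Finset.lcm_eq_zero_iff]
    rintro ⟨i, hi, h0⟩
    have hi := Finset.mem_Icc.1 hi
    have := hpos i (Finset.mem_Icc.2 (by omega))
    omega
  refine ⟨L * p^(2+m), B, Nat.mul_pos hL0 (hppos _), hB0, ?_, ?_⟩
  · intro x hA hx
    obtain ⟨f, hf, hd⟩ := hss x hx
    have hf2 := hff x f hf hd
    obtain ⟨r, hr, hrd, hrL⟩ : ∃ r, Irreducible r ∧ r ∣ (x : Matrix (Fin (2+m)) (Fin (2+m)) F).charpoly ∧ ¬ r ∣ X^L-1 := by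
      by_contra! hc
      exact hA ((sl_pow _ _).2 (kill _ L hc))
    have hrm : m ≤ r.natDegree := by
      by_contra! hlt
      apply hrL
      refine pow_dvd_X r _ _ ?_ (irr_dvd _ x.2 r hr hrd)
      rw [hL, hq]
      exact Finset.dvd_lcm (f := fun i => q^i-1) (Finset.mem_Icc.2 ⟨hr.natDegree_pos, by omega⟩)
    have hcop : ∀ s : F[X], Irreducible s → s.natDegree < m → IsCoprime s r := by
      intro s hs hlt
      rw [hs.coprime_iff_not_dvd]
      intro hsr
      have := natDegree_eq_of_degree_eq (degree_eq_degree_of_associated (hs.associated_of_dvd hr hsr))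
      omega
    have hc1 := hcop f hf (by omega)
    have hall := natDegree_le_of_dvd ((hc1.mul_left hc1).mul_dvd hd hrd) (Matrix.charpoly_monic _).ne_zero
    rw [hdeg, natDegree_mul (mul_ne_zero hf.ne_zero hf.ne_zero) hr.ne_zero, natDegree_mul hf.ne_zero hf.ne_zero] at hall
    have hfp := hf.natDegree_pos
    obtain ⟨a, g, hg⟩ := deg_one_sq _ f hf hd (by omega)
    obtain ⟨hm', hgd⟩ := hgdeg x a g hg
    have hc2 := hcop (X - C a) (irreducible_X_sub_C a) (by rw [natDegree_X_sub_C]; omega)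
    have hrg : r ∣ g := by
      rw [hg] at hrd
      exact (hc2.pow_left (m := 2)).symm.dvd_of_dvd_mul_left hrd
    have hass : Associated r g := by
      obtain ⟨c, hc⟩ := hrg
      have hc0 : c ≠ 0 := by rintro rfl; simp at hc; exact hm'.ne_zero hc
      have : c.natDegree = 0 := by
        have := natDegree_mul hr.ne_zero hc0
        rw [← hc] at this
        omega
      have hu : IsUnit c := by
        rw [isUnit_iff_degree_eq_zero, degree_eq_natDegree hc0, this]; rfl
      exact ⟨hu.unit, hc.symm⟩
    have hgi : Irreducible g := hass.irreducible hr
    refine fin_core x a g B (hBall x) hg ?_ (hBall x g hgi (hg ▸ Dvd.intro_left _ rfl)) hx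
    intro hev
    have h1 := natDegree_eq_of_degree_eq (degree_eq_degree_of_associated
      ((irreducible_X_sub_C a).associated_of_dvd hgi (dvd_iff_isRoot.2 hev)))
    rw [natDegree_X_sub_C] at h1
    omega
  · have : NeZero m := ⟨by omega⟩
    obtain ⟨Y, hY, hY2⟩ := exY F p m
    obtain ⟨x, hx⟩ := ex m (1:F) Y (by simp [hY])
    refine ⟨x, fun h => ?_, fun h => hBF (hx _ h).1⟩
    have := hY2 _ _ (hx _ h).2.2
    rw [hq, hL] at this
    exact num q m hq2 (by omega) this
end

section
/- Let F be a field, n ≥ 2, and let a, b be transvections in SL_n(F). Then the commutator g = [a,b] = a^{−1}b^{−1}ab satisfies rank(g − 1) ≤ 2; and if g is unipotent (i.e., g − 1 is nilpotent), then g is the identity or a transvection. In particular, a unipotent element with Jordan normal form a single Jordan block of size 3, or a direct sum of two Jordan blocks of size 2, is not a commutator of two transvections. -/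
theorem rank_add_le_aux {n : ℕ} {F : Type*} [Field F] (A B : Matrix (Fin n) (Fin n) F) :
    (A + B).rank ≤ A.rank + B.rank := by
  unfold Matrix.rank
  rw [Matrix.mulVecLin_add]
  refine le_trans (Submodule.finrank_mono ?_) (Submodule.finrank_add_le_finrank_add_finrank _ _)
  rintro _ ⟨x, rfl⟩
  exact Submodule.add_mem_sup ⟨x, rfl⟩ ⟨x, rfl⟩

theorem rank_zero_aux {n : ℕ} {F : Type*} [Field F] (A : Matrix (Fin n) (Fin n) F)
    (h : A.rank = 0) : A = 0 := by
  unfold Matrix.rank at h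
  rw [Submodule.finrank_eq_zero, LinearMap.range_eq_bot] at h
  ext i j
  have := congrFun (LinearMap.congr_fun h (Pi.single j 1)) i
  simpa using this

theorem rank_one_aux {n : ℕ} {F : Type*} [Field F] (A : Matrix (Fin n) (Fin n) F)
    (h : A.rank = 1) : ∃ u v : Fin n → F, A = Matrix.vecMulVec u v := by
  unfold Matrix.rank at h
  obtain ⟨w, hw⟩ := finrank_le_one_iff.mp h.le
  have h2 : ∀ j : Fin n, ∃ c : F, c • (w : Fin n → F) = A.mulVecLin (Pi.single j 1) := by
    intro j
    obtain ⟨c, hc⟩ := hw ⟨_, LinearMap.mem_range_self _ (Pi.single j 1)⟩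
    exact ⟨c, congrArg Subtype.val hc⟩
  choose c hc using h2
  refine ⟨w, c, ?_⟩
  ext i j
  have := congrFun (hc j) i
  simp at this
  rw [Matrix.vecMulVec_apply, mul_comm, this]

theorem trans_inv_aux {n : ℕ} {F : Type*} [Field F]
    (a : Matrix.SpecialLinearGroup (Fin n) F) (A : Matrix (Fin n) (Fin n) F)
    (h : (a : Matrix (Fin n) (Fin n) F) = 1 + A) (h2 : A * A = 0) :
    ((a⁻¹ : Matrix.SpecialLinearGroup (Fin n) F) : Matrix (Fin n) (Fin n) F) = 1 - A := by
  have h1 : ((a⁻¹ : Matrix.SpecialLinearGroup (Fin n) F) : Matrix (Fin n) (Fin n) F) *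
      (a : Matrix (Fin n) (Fin n) F) = 1 := by
    rw [← Matrix.SpecialLinearGroup.coe_mul, inv_mul_cancel, Matrix.SpecialLinearGroup.coe_one]
  have h3 : (a : Matrix (Fin n) (Fin n) F) * (1 - A) = 1 := by
    rw [h]; noncomm_ring; simp [h2]
  exact left_inv_eq_right_inv h1 h3

theorem prod_aux {R : Type*} [Ring R] (A B : R) (hA : A * A = 0) (hB : B * B = 0) :
    (1 - A) * (1 - B) * (1 + A) * (1 + B) - 1 =
      (1 - A) * (1 - B) * (A * B) + (- ((1 - A) * (1 - B) * B)) * A := by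
  have h : (1 - A) * (1 - B) * ((1 + B) * (1 + A)) = 1 := by
    have h1 : (1 - B) * (1 + B) = 1 := by noncomm_ring; simp [hB]
    have h2 : (1 - A) * (1 + A) = 1 := by noncomm_ring; simp [hA]
    calc _ = (1 - A) * ((1 - B) * (1 + B)) * (1 + A) := by noncomm_ring
      _ = 1 := by rw [h1, mul_one, h2]
  generalize (1 - A) * (1 - B) = X at h ⊢
  calc X * (1 + A) * (1 + B) - 1 = X * (1 + A) * (1 + B) - X * ((1 + B) * (1 + A)) := by rw [h]
    _ = _ := by noncomm_ring

theorem prod_aux2 {R : Type*} [Ring R] (A B : R) (hA : A * A = 0) (hB : B * B = 0) :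
    (1 - A) * (1 - B) * (1 + A) * (1 + B) - 1 =
      A * B - B * A + A * B * A - B * A * B + A * B * (A * B) := by
  rw [prod_aux A B hA hB]
  have e1 : A * (A * B) = 0 := by rw [← mul_assoc, hA, zero_mul]
  have e2 : B * (B * A) = 0 := by rw [← mul_assoc, hB, zero_mul]
  have : (1 - A) * (1 - B) * (A * B) + (- ((1 - A) * (1 - B) * B)) * A =
    A * B - B * A + A * B * A - B * A * B + A * B * (A * B)
     - A * (A * B) + B * (B * A) - A * (B * (B * A)) := by noncomm_ring
  rw [this, e1, e2]; simp

theorem stmt18 (F : Type*) [Field F] (n : ℕ) (hn : 2 ≤ n)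
    (a b : Matrix.SpecialLinearGroup (Fin n) F)
    (ha : IsTransvection a) (hb : IsTransvection b) :
    ∀ g : Matrix.SpecialLinearGroup (Fin n) F, g = a⁻¹ * b⁻¹ * a * b →
      ((g : Matrix (Fin n) (Fin n) F) - 1).rank ≤ 2 ∧
      (IsNilpotent ((g : Matrix (Fin n) (Fin n) F) - 1) →
        g = 1 ∨ IsTransvection g) ∧
      -- in particular, `g` is not a unipotent single Jordan block of size 3:
      ¬(((g : Matrix (Fin n) (Fin n) F) - 1) ^ 3 = 0 ∧
          ((g : Matrix (Fin n) (Fin n) F) - 1) ^ 2 ≠ 0 ∧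
          ((g : Matrix (Fin n) (Fin n) F) - 1).rank = 2) ∧
      -- and `g` is not a unipotent direct sum of two Jordan blocks of size 2:
      ¬(((g : Matrix (Fin n) (Fin n) F) - 1) ^ 2 = 0 ∧
          ((g : Matrix (Fin n) (Fin n) F) - 1).rank = 2) := by
  intro g hg
  obtain ⟨-, ra, sa⟩ := ha
  obtain ⟨-, rb, sb⟩ := hb
  set A := (a : Matrix (Fin n) (Fin n) F) - 1 with hA
  set B := (b : Matrix (Fin n) (Fin n) F) - 1 with hB
  rw [pow_two] at sa sb
  have ea : (a : Matrix (Fin n) (Fin n) F) = 1 + A := by rw [hA]; abel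
  have eb : (b : Matrix (Fin n) (Fin n) F) = 1 + B := by rw [hB]; abel
  have hG : (g : Matrix (Fin n) (Fin n) F) - 1 = (1 - A) * (1 - B) * (1 + A) * (1 + B) - 1 := by
    rw [hg]
    simp only [Matrix.SpecialLinearGroup.coe_mul]
    rw [trans_inv_aux a A ea sa, trans_inv_aux b B eb sb, ← ea, ← eb]
  have hG1 := hG.trans (prod_aux A B sa sb)
  have hG2 := hG.trans (prod_aux2 A B sa sb)
  have key : IsNilpotent ((g : Matrix (Fin n) (Fin n) F) - 1) → g = 1 ∨ IsTransvection g := by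
    intro hnil
    have ht := (Matrix.isNilpotent_trace_of_isNilpotent hnil).eq_zero
    obtain ⟨u, v, huv⟩ := rank_one_aux A ra
    obtain ⟨x, y, hxy⟩ := rank_one_aux B rb
    have t1 : (A * B * A).trace = 0 := by
      rw [Matrix.trace_mul_comm, ← mul_assoc, sa]; simp
    have t2 : (B * A * B).trace = 0 := by
      rw [Matrix.trace_mul_comm, ← mul_assoc, sb]; simp
    have t3 : (A * B * (A * B)).trace = 0 := by
      rw [hG2] at ht
      simpa [t1, t2, Matrix.trace_mul_comm A B] using ht
    have hAB : A * B = (dotProduct v x) • Matrix.vecMulVec u y := by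
      rw [huv, hxy, Matrix.vecMulVec_mul_vecMulVec, Matrix.vecMulVec_smul]
    have hBA : B * A = (dotProduct y u) • Matrix.vecMulVec x v := by
      rw [huv, hxy, Matrix.vecMulVec_mul_vecMulVec, Matrix.vecMulVec_smul]
    have hz : A * B = 0 ∨ B * A = 0 := by
      rw [hAB] at t3
      simp only [Matrix.smul_mul, Matrix.mul_smul, Matrix.vecMulVec_mul_vecMulVec,
        Matrix.vecMulVec_smul, Matrix.trace_smul, Matrix.trace_vecMulVec, smul_eq_mul,
        mul_eq_zero] at t3
      rw [dotProduct_comm u y] at t3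
      have : dotProduct v x = 0 ∨ dotProduct y u = 0 := by tauto
      rcases this with h | h
      · left; rw [hAB, h, zero_smul]
      · right; rw [hBA, h, zero_smul]
    have hfin : ((g : Matrix (Fin n) (Fin n) F) - 1).rank ≤ 1 ∧
        ((g : Matrix (Fin n) (Fin n) F) - 1) ^ 2 = 0 := by
      rcases hz with h | h
      · have e : (g : Matrix (Fin n) (Fin n) F) - 1 = (-B) * A := by
          rw [hG2, mul_assoc B A B, h]; simp
        rw [e]
        refine ⟨(Matrix.rank_mul_le_right _ _).trans ra.le, ?_⟩
        have : ((-B) * A) ^ 2 = B * (A * B) * A := by noncomm_ring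
        rw [this, h]; simp
      · have e : (g : Matrix (Fin n) (Fin n) F) - 1 = A * B := by
          rw [hG2, mul_assoc A B A, h]; simp [← mul_assoc, mul_assoc A B A, h]
        rw [e]
        refine ⟨(Matrix.rank_mul_le_right _ _).trans rb.le, ?_⟩
        have : (A * B) ^ 2 = A * (B * A) * B := by noncomm_ring
        rw [this, h]; simp
    by_cases h1 : g = 1
    · exact Or.inl h1
    · refine Or.inr ⟨h1, le_antisymm hfin.1 ?_, hfin.2⟩
      by_contra hlt
      have h0 : ((g : Matrix (Fin n) (Fin n) F) - 1).rank = 0 := by omega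
      replace h0 := rank_zero_aux _ h0
      apply h1
      apply Subtype.ext
      simpa using sub_eq_zero.mp h0
  have key2 : IsNilpotent ((g : Matrix (Fin n) (Fin n) F) - 1) →
      ((g : Matrix (Fin n) (Fin n) F) - 1).rank ≠ 2 := by
    intro h h2
    rcases key h with h1 | h1
    · rw [h1] at h2; simp at h2
    · have := h1.2.1; omega
  refine ⟨?_, key, fun h => key2 ⟨3, h.1⟩ h.2.2, fun h => key2 ⟨2, h.1⟩ h.2⟩
  rw [hG1]
  refine (rank_add_le_aux _ _).trans ?_
  have r1 := (Matrix.rank_mul_le_right ((1 - A) * (1 - B)) (A * B)).trans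
    (Matrix.rank_mul_le_right A B)
  have r2 := Matrix.rank_mul_le_right (-((1 - A) * (1 - B) * B)) A
  omega
end

section
/- For every n ≥ 2 with n ∉ {3,4} and every finite field F of cardinality q, there exists a group word w(x_1,x_2) in the free group F_2 on two generators such that the set of values of w in the general linear group GL_n(F) consists exactly of the identity and all transvections. -/
/-- A transvection in `GL_n(F)`: `g ≠ 1`, `det g = 1`, `g - 1` has rank 1 and
`(g - 1)² = 0`. -/
def IsGLTransvection {n : ℕ} {F : Type*} [Field F] (g : GL (Fin n) F) : Prop :=
  g ≠ 1 ∧ Matrix.det (g : Matrix (Fin n) (Fin n) F) = 1 ∧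
    ((g : Matrix (Fin n) (Fin n) F) - 1).rank = 1 ∧
    ((g : Matrix (Fin n) (Fin n) F) - 1) ^ 2 = 0


set_option linter.unusedSectionVars false

namespace TV

open Polynomial Module

lemma gcd_lcm_dvd (a b c : ℕ) (ha : a ≠ 0) (hb : b ≠ 0) (hc : c ≠ 0) :
    Nat.gcd (Nat.lcm a b) c ∣ Nat.lcm (Nat.gcd a c) (Nat.gcd b c) := by
  have h1 : Nat.gcd a c ≠ 0 := Nat.gcd_ne_zero_right hc
  have h2 : Nat.gcd b c ≠ 0 := Nat.gcd_ne_zero_right hc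
  rw [← Nat.factorization_le_iff_dvd (Nat.gcd_ne_zero_right hc) (Nat.lcm_ne_zero h1 h2)]
  rw [Nat.factorization_gcd (Nat.lcm_ne_zero ha hb) hc, Nat.factorization_lcm ha hb,
    Nat.factorization_lcm h1 h2, Nat.factorization_gcd ha hc, Nat.factorization_gcd hb hc]
  intro p
  simp only [Finsupp.inf_apply, Finsupp.sup_apply, inf_sup_right]
  exact le_rfl

lemma exists_L (q m : ℕ) (hq : 2 ≤ q) (hm : 3 ≤ m) :
    ∃ L : ℕ, L ≠ 0 ∧ (∀ i, 1 ≤ i → i ≤ m + 2 → i ≠ m → q ^ i - 1 ∣ L) ∧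
      ¬ (q ^ m - 1 ∣ L * (q - 1)) := by
  have hpos : ∀ i, 1 ≤ i → 1 < q ^ i := fun i hi => Nat.one_lt_pow (by omega) (by omega)
  obtain ⟨D, hD, hD2⟩ : ∃ D : ℕ, q ^ m - 1 = D * (eval (q : ℤ) (cyclotomic m ℤ)).natAbs ∧
      ∀ d ∈ m.properDivisors, q ^ d - 1 ∣ D := by
    have hdv : ∀ d ∈ m.properDivisors,
        (q ^ d - 1) * (eval (q : ℤ) (cyclotomic m ℤ)).natAbs ∣ q ^ m - 1 := by
      intro d hd
      have h := map_dvd (evalRingHom (q:ℤ)) (X_pow_sub_one_mul_cyclotomic_dvd_X_pow_sub_one_of_dvd ℤ hd)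
      have h' := Int.natAbs_dvd_natAbs.2 h
      simp only [map_mul, map_sub, map_pow, map_one, coe_evalRingHom, eval_X, Int.natAbs_mul] at h'
      have e : ∀ k : ℕ, ((q:ℤ)^k - 1).natAbs = q ^ k - 1 := by
        intro k
        have : 1 ≤ q ^ k := Nat.one_le_pow _ _ (by omega)
        zify [this]
        rw [abs_of_nonneg]
        have : (1:ℤ) ≤ (q:ℤ)^k := by exact_mod_cast this
        omega
      rwa [e, e] at h'
    have h1 := hdv 1 (by simp; omega)
    have hc : (eval (q : ℤ) (cyclotomic m ℤ)).natAbs ∣ q ^ m - 1 := (Dvd.intro_left _ rfl).trans h1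
    obtain ⟨D, hD⟩ := hc
    refine ⟨D, by rw [hD, mul_comm], ?_⟩
    intro d hd
    have := hdv d hd
    rw [hD, mul_comm] at this
    refine Nat.dvd_of_mul_dvd_mul_left ?_ this
    have := hpos m (by omega)
    rcases Nat.eq_zero_or_pos (eval (q : ℤ) (cyclotomic m ℤ)).natAbs with h | h
    · rw [h] at hD; omega
    · exact h
  have hmne : q ^ m - 1 ≠ 0 := by have := hpos m (by omega); omega
  have key : ∀ s : Finset ℕ, (∀ i ∈ s, 1 ≤ i ∧ i ≤ m + 2 ∧ i ≠ m) →
      ∃ L : ℕ, L ≠ 0 ∧ (∀ i ∈ s, q ^ i - 1 ∣ L) ∧ Nat.gcd L (q ^ m - 1) ∣ D := by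
    intro s
    induction s using Finset.induction_on with
    | empty => intro _; exact ⟨1, by simp⟩
    | insert a s ha ih =>
      intro h
      obtain ⟨L, hL0, hL, hg⟩ := ih (fun i hi => h i (Finset.mem_insert_of_mem hi))
      obtain ⟨a1, a2, a3⟩ := h a (Finset.mem_insert_self _ _)
      have ha0 : q ^ a - 1 ≠ 0 := by have := hpos a a1; omega
      refine ⟨Nat.lcm (q ^ a - 1) L, Nat.lcm_ne_zero ha0 hL0, ?_, ?_⟩
      · intro i hi
        rcases Finset.mem_insert.1 hi with rfl | hi
        · exact Nat.dvd_lcm_left _ _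
        · exact (hL i hi).trans (Nat.dvd_lcm_right _ _)
      · refine (gcd_lcm_dvd _ _ _ ha0 hL0 hmne).trans (Nat.lcm_dvd ?_ hg)
        rw [Nat.pow_sub_one_gcd_pow_sub_one]
        apply hD2
        rw [Nat.mem_properDivisors]
        refine ⟨Nat.gcd_dvd_right _ _, lt_of_le_of_ne (Nat.le_of_dvd (by omega) (Nat.gcd_dvd_right _ _)) ?_⟩
        intro he
        have : m ∣ a := he ▸ Nat.gcd_dvd_left a m
        obtain ⟨k, rfl⟩ := this
        rcases k with _ | _ | k
        · omega
        · omega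
        · nlinarith
  obtain ⟨L, hL0, hL, hg⟩ := key ((Finset.Icc 1 (m+2)).erase m) (by
    intro i hi; simp at hi; omega)
  refine ⟨L, hL0, fun i h1 h2 h3 => hL i (by simp; omega), ?_⟩
  intro hdvd
  have h1 : q ^ m - 1 ∣ Nat.gcd L (q^m-1) * (q - 1) := by
    rw [← Nat.gcd_mul_right]
    exact Nat.dvd_gcd hdvd (Dvd.intro _ rfl)
  have h2 : q ^ m - 1 ∣ D * (q - 1) := h1.trans (Nat.mul_dvd_mul_right hg _)
  rw [hD] at h2
  have hD0 : 0 < D := by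
    rcases Nat.eq_zero_or_pos D with h | h
    · rw [h] at hD; omega
    · exact h
  have h3 := Nat.le_of_dvd (by omega) (Nat.dvd_of_mul_dvd_mul_left hD0 h2)
  have := sub_one_lt_natAbs_cyclotomic_eval (n := m) (q := q) (by omega) (by omega)
  omega

lemma dvd_pow_of_irr {R : Type*} [CommMonoidWithZero R] [WfDvdMonoid R] (b : R) (a : R) (ha : a ≠ 0)
    (h : ∀ f, Irreducible f → f ∣ a → f ∣ b) : ∃ k, a ∣ b ^ k := by
  induction a using WfDvdMonoid.induction_on_irreducible with
  | zero => exact absurd rfl ha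
  | unit u hu => exact ⟨0, by simpa using hu.dvd⟩
  | mul a i ha0 hi ih =>
    obtain ⟨k, hk⟩ := ih ha0 (fun f hf hd => h f hf (hd.mul_left _))
    exact ⟨k + 1, by rw [pow_succ']; exact mul_dvd_mul (h i hi (Dvd.intro _ rfl)) hk⟩

variable {F V : Type} [Field F] [Fintype F] [AddCommGroup V] [Module F V] [Module.Finite F V]

lemma irr_dvd (f : F[X]) (hf : Irreducible f) (hX : ¬ f ∣ X) (N : ℕ)
    (hN : Fintype.card F ^ f.natDegree - 1 ∣ N) : f ∣ X ^ N - 1 := by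
  have h := (hf.natDegree_dvd_iff_dvd_X_pow_card_pow_sub_X (n := f.natDegree)).1 dvd_rfl
  rw [Nat.card_eq_fintype_card] at h
  have h1 : 1 ≤ Fintype.card F ^ f.natDegree := Nat.one_le_pow _ _ Fintype.card_pos
  have e : (X : F[X]) ^ Fintype.card F ^ f.natDegree - X =
      X * (X ^ (Fintype.card F ^ f.natDegree - 1) - 1) := by
    rw [mul_sub, ← pow_succ', Nat.sub_add_cancel h1, mul_one]
  rw [e] at h
  obtain ⟨k, rfl⟩ := hN
  refine ((hf.prime.dvd_or_dvd h).resolve_left hX).trans ?_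
  rw [pow_mul]
  simpa using sub_dvd_pow_sub_pow ((X : F[X]) ^ (Fintype.card F ^ f.natDegree - 1)) 1 k

lemma ker_of_dvd (y : End F V) (f : F[X]) (hf : Irreducible f) (hd : f ∣ minpoly F y) :
    ∃ v, v ≠ 0 ∧ aeval y f v = 0 := by
  by_contra! hcon
  obtain ⟨g, hg⟩ := hd
  have hint : IsIntegral F y := Algebra.IsIntegral.isIntegral y
  have hne := minpoly.ne_zero hint
  have h0 : aeval y g = 0 := by
    ext v
    have : aeval y f (aeval y g v) = 0 := by
      rw [← Module.End.mul_apply, ← map_mul, ← hg, minpoly.aeval]; rfl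
    by_contra h
    exact hcon _ h this
  have hg0 : g ≠ 0 := by rintro rfl; simp at hg; exact hne hg
  have := minpoly.dvd F y h0
  rw [hg] at this
  have h2 := Polynomial.natDegree_le_of_dvd this hg0
  rw [natDegree_mul hf.ne_zero hg0] at h2
  have := hf.natDegree_pos
  omega

lemma not_dvd_X (y : (End F V)ˣ) (f : F[X]) (hf : Irreducible f) (hd : f ∣ minpoly F (y : End F V)) :
    ¬ f ∣ X := by
  intro h
  obtain ⟨v, hv, hv0⟩ := ker_of_dvd (y : End F V) f hf hd
  obtain ⟨g, hg⟩ := h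
  have : aeval (y : End F V) (X : F[X]) v = 0 := by
    rw [hg, mul_comm, map_mul, Module.End.mul_apply, hv0, map_zero]
  rw [aeval_X] at this
  apply hv
  have h2 : ((y⁻¹ * y : (End F V)ˣ) : End F V) v = 0 := by
    rw [Units.val_mul, Module.End.mul_apply, this, map_zero]
  simpa using h2

lemma natDegree_le (y : End F V) (f : F[X]) (hd : f ∣ minpoly F y) :
    f.natDegree ≤ finrank F V := by
  rw [← LinearMap.charpoly_natDegree y]
  exact natDegree_le_of_dvd (hd.trans (LinearMap.minpoly_dvd_charpoly y))
    (LinearMap.charpoly_monic y).ne_zero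

lemma nil_of (y : (End F V)ˣ) (N : ℕ) (h : ∀ f, Irreducible f → f ∣ minpoly F (y : End F V) →
    Fintype.card F ^ f.natDegree - 1 ∣ N) : IsNilpotent ((y : End F V) ^ N - 1) := by
  obtain ⟨k, g, hk⟩ := dvd_pow_of_irr ((X : F[X]) ^ N - 1) (minpoly F (y : End F V))
    (minpoly.ne_zero (Algebra.IsIntegral.isIntegral _))
    (fun f hf hd => irr_dvd f hf (not_dvd_X y f hf hd) N (h f hf hd))
  refine ⟨k, ?_⟩
  have := congrArg (aeval (y : End F V)) hk
  simpa using this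

lemma pow_fin_nil (N : End F V) (h : IsNilpotent N) : N ^ finrank F V = 0 := by
  have h1 := (LinearMap.charpoly_eq_X_pow_iff N).2 ?_
  · have := LinearMap.aeval_self_charpoly N
    rwa [h1, map_pow, aeval_X] at this
  · obtain ⟨k, hk⟩ := h
    intro m
    exact ⟨k, by rw [hk]; rfl⟩

def A (F : Type) [Fintype F] (n : ℕ) : ℕ := ∏ i ∈ Finset.Icc 1 n, (Fintype.card F ^ i - 1)

lemma dvd_A (n i : ℕ) (h1 : 1 ≤ i) (h2 : i ≤ n) : Fintype.card F ^ i - 1 ∣ A F n :=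
  Finset.dvd_prod_of_mem (fun i => Fintype.card F ^ i - 1) (by simp; omega)

lemma A_ne (n : ℕ) : ((A F n : ℕ) : F) ≠ 0 := by
  unfold A
  push_cast
  rw [Finset.prod_ne_zero_iff]
  intro i hi
  simp at hi
  rw [Nat.cast_sub (Nat.one_le_pow _ _ Fintype.card_pos)]
  have : i ≠ 0 := by omega
  simp [this]

lemma nil_A (y : (End F V)ˣ) : IsNilpotent ((y : End F V) ^ A F (finrank F V) - 1) :=
  nil_of y _ fun f hf hd => dvd_A _ _ hf.natDegree_pos (natDegree_le _ f hd)

lemma pow_B (y : (End F V)ˣ) (L : ℕ) (h : IsNilpotent ((y : End F V) ^ L - 1)) :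
    (y : End F V) ^ (L * Fintype.card F ^ finrank F V) = 1 := by
  have h1 := pow_fin_nil _ h
  have h2 : ((y : End F V) ^ L - 1) ^ (Fintype.card F ^ finrank F V) = 0 :=
    pow_eq_zero_of_le (Nat.lt_pow_self Fintype.one_lt_card).le h1
  obtain ⟨p, hp⟩ := CharP.exists F
  obtain ⟨e, hp', hc⟩ := FiniteField.card F p
  have : Fact p.Prime := ⟨hp'⟩
  have h3 := sub_pow_char_pow ((X : F[X]) ^ L) 1 (p := p) (e * finrank F V)
  have h4 := congrArg (aeval (y : End F V)) h3
  rw [pow_mul p, ← hc] at h4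
  simp only [map_pow, map_sub, aeval_X, map_one, one_pow] at h4
  rw [h2] at h4
  rw [pow_mul]
  exact (sub_eq_zero.1 h4.symm)

lemma rank_le_one (N : End F V) (W : Submodule F V) (hN : IsNilpotent N)
    (hW : finrank F W ≤ 2) (h1 : LinearMap.range N ≤ W) (h2 : LinearMap.range N ≤ W.map N) :
    finrank F (LinearMap.range N) ≤ 1 := by
  by_contra hcon
  have he : LinearMap.range N = W := Submodule.eq_of_le_of_finrank_le h1 (by omega)
  have hk : ∀ k : ℕ, W ≤ W.map (N ^ k) := by
    intro k
    induction k with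
    | zero => intro v hv; exact ⟨v, hv, by simp⟩
    | succ k ih =>
      intro v hv
      obtain ⟨w, hw, rfl⟩ := ih hv
      obtain ⟨w', hw', rfl⟩ := h2 (he ▸ hw)
      exact ⟨w', hw', by rw [pow_succ]; rfl⟩
  obtain ⟨k, hk0⟩ := hN
  have hb : W = ⊥ := by
    rw [eq_bot_iff]
    intro v hv
    obtain ⟨w, hw, rfl⟩ := hk k hv
    rw [hk0]; simp
  rw [he, hb, finrank_bot] at hcon
  omega

lemma cyclic_dim (y : End F V) (f : F[X]) (hf : Irreducible f) (U : Submodule F V)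
    (hU : ∀ x ∈ U, y x ∈ U) (v : V) (hv : v ≠ 0) (hvU : v ∈ U) (h0 : aeval y f v = 0) :
    f.natDegree ≤ finrank F U := by
  have hmem : ∀ p : F[X], aeval y p v ∈ U := by
    intro p
    induction p using Polynomial.induction_on' with
    | add p q hp hq => rw [map_add, LinearMap.add_apply]; exact U.add_mem hp hq
    | monomial n a =>
      rw [aeval_monomial, Module.End.mul_apply, Module.algebraMap_end_apply]
      apply U.smul_mem
      induction n with
      | zero => simpa
      | succ n ih => rw [pow_succ', Module.End.mul_apply]; exact hU _ ih
  let φ : degreeLT F f.natDegree →ₗ[F] U :=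
    { toFun := fun p => ⟨aeval y (p : F[X]) v, hmem _⟩
      map_add' := by intro a b; ext; simp
      map_smul' := by intro a b; ext; simp }
  have hinj : Function.Injective φ := by
    rw [← LinearMap.ker_eq_bot, eq_bot_iff]
    rintro ⟨p, hp⟩ hker
    have hp0 : aeval y p v = 0 := congrArg Subtype.val (LinearMap.mem_ker.1 hker)
    by_contra hne
    have hpne : p ≠ 0 := by rintro rfl; exact hne (by simp)
    have hnd : ¬ f ∣ p := by
      intro hd
      have := natDegree_le_of_dvd hd hpne
      rw [mem_degreeLT] at hp
      have := (natDegree_lt_iff_degree_lt hpne).2 hp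
      omega
    obtain ⟨a, b, hab⟩ := (hf.coprime_iff_not_dvd.2 hnd)
    have := congrArg (fun g => aeval y g v) hab
    simp only [map_add, map_mul, LinearMap.add_apply, Module.End.mul_apply, h0, hp0, map_zero, map_one,
      add_zero, Module.End.one_apply] at this
    exact hv this.symm
  have := LinearMap.finrank_le_finrank_of_injective hinj
  rwa [finrank_eq_card_basis (degreeLT.basis F f.natDegree), Fintype.card_fin] at this

lemma rank_A (y : (End F V)ˣ) (m L : ℕ) (hm : 3 ≤ m) (hn : finrank F V = m + 2)
    (hL : ∀ i, 1 ≤ i → i ≤ m + 2 → i ≠ m → Fintype.card F ^ i - 1 ∣ L)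
    (hB : (y : End F V) ^ (L * Fintype.card F ^ finrank F V) ≠ 1) :
    finrank F (LinearMap.range ((y : End F V) ^ A F (finrank F V) - 1)) ≤ 1 := by
  obtain ⟨f, hf, hd, hdeg⟩ : ∃ f, Irreducible f ∧ f ∣ minpoly F (y : End F V) ∧ f.natDegree = m := by
    by_contra! hcon
    refine hB (pow_B y L (nil_of y L fun f hf hd => hL _ hf.natDegree_pos ?_ (hcon f hf hd)))
    rw [← hn]; exact natDegree_le _ f hd
  obtain ⟨v, hv, hv0⟩ := ker_of_dvd (y : End F V) f hf hd
  obtain ⟨g, hg⟩ := irr_dvd f hf (not_dvd_X y f hf hd) (A F (finrank F V))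
    (dvd_A _ _ hf.natDegree_pos (natDegree_le _ f hd))
  have hcomm : ∀ p : F[X], ∀ x, aeval (y : End F V) p ((y : End F V) x) = (y : End F V) (aeval (y : End F V) p x) := by
    intro p x
    have : aeval (y : End F V) (p * X) = aeval (y : End F V) (X * p) := by rw [mul_comm]
    simpa using congrArg (fun l => l x) this
  set W := LinearMap.range (aeval (y : End F V) f) with hWdef
  have hN : (y : End F V) ^ A F (finrank F V) - 1 = aeval (y : End F V) f * aeval (y : End F V) g := by
    rw [← map_mul, ← hg]; simp
  have hN' : (y : End F V) ^ A F (finrank F V) - 1 = aeval (y : End F V) g * aeval (y : End F V) f := by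
    rw [← map_mul, mul_comm, ← hg]; simp
  have hW : finrank F W ≤ 2 := by
    have h1 := LinearMap.finrank_range_add_finrank_ker (aeval (y : End F V) f)
    have h2 := cyclic_dim (y : End F V) f hf (LinearMap.ker (aeval (y : End F V) f)) (by
      intro x hx
      rw [LinearMap.mem_ker] at hx ⊢
      rw [hcomm, hx, map_zero]) v hv hv0 hv0
    rw [hWdef]
    omega
  have hWinv : ∀ x ∈ W, (y : End F V) x ∈ W := by
    rintro _ ⟨x, rfl⟩
    exact ⟨(y : End F V) x, hcomm _ _⟩
  have hfW : W.map (aeval (y : End F V) f) = W := by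
    apply Submodule.eq_of_le_of_finrank_le
    · rintro _ ⟨x, _, rfl⟩; exact ⟨x, rfl⟩
    · have hinj : Function.Injective ((aeval (y : End F V) f).domRestrict W) := by
        rw [← LinearMap.ker_eq_bot, eq_bot_iff]
        rintro ⟨x, hx⟩ hker
        have hx0 : aeval (y : End F V) f x = 0 := hker
        by_contra hne
        have := cyclic_dim (y : End F V) f hf W hWinv x (by
          rintro rfl; exact hne (by simp)) hx hx0
        omega
      rw [← LinearMap.range_domRestrict, LinearMap.finrank_range_of_inj hinj]
  apply rank_le_one _ W (nil_A y) hW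
  · rw [hN]; rintro _ ⟨x, rfl⟩; exact ⟨_, rfl⟩
  · rintro _ ⟨x, rfl⟩
    have : aeval (y : End F V) f x ∈ W.map (aeval (y : End F V) f) := by rw [hfW]; exact ⟨x, rfl⟩
    obtain ⟨w, hw, hwx⟩ := this
    refine ⟨w, hw, ?_⟩
    rw [hN', Module.End.mul_apply, hwx, Module.End.mul_apply]

lemma exists_uf (N : End F V) (h : finrank F (LinearMap.range N) ≤ 1) (hN : IsNilpotent N) :
    ∃ (f : Dual F V) (u : V), (∀ v, N v = f v • u) ∧ f u = 0 := by
  obtain ⟨⟨u, hu⟩, hc⟩ := finrank_le_one_iff.1 h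
  obtain ⟨f, hf⟩ : ∃ f : Dual F V, ∀ v, N v = f v • u := by
    by_cases hu0 : u = 0
    · refine ⟨0, fun v => ?_⟩
      obtain ⟨c, hc⟩ := hc ⟨N v, v, rfl⟩
      have := congrArg Subtype.val hc
      simp [hu0] at this
      simp [← this]
    · have hm : ∀ v, N v ∈ Submodule.span F {u} := by
        intro v
        obtain ⟨c, hc⟩ := hc ⟨N v, v, rfl⟩
        exact Submodule.mem_span_singleton.2 ⟨c, congrArg Subtype.val hc⟩
      refine ⟨(LinearEquiv.toSpanNonzeroSingleton F V u hu0).symm.toLinearMap ∘ₗ N.codRestrict _ hm, ?_⟩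
      intro v
      have := LinearEquiv.toSpanNonzeroSingleton_symm_apply_smul F V u hu0 ⟨N v, hm v⟩
      exact this.symm
  refine ⟨f, u, hf, ?_⟩
  by_contra hfu
  obtain ⟨k, hk⟩ := hN
  have : ∀ k : ℕ, (N ^ k) u = (f u) ^ k • u := by
    intro k
    induction k with
    | zero => simp
    | succ k ih => rw [pow_succ', Module.End.mul_apply, ih, map_smul, hf, smul_smul, pow_succ]
  have h0 := this k
  rw [hk] at h0
  have : u = 0 := by
    rcases smul_eq_zero.1 h0.symm with h | h
    · exact absurd h (pow_ne_zero _ hfu)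
    · exact h
  rw [this] at hfu
  simp at hfu

lemma range_pow_le (c : End F V) (k : ℕ) : LinearMap.range (c ^ k - 1) ≤ LinearMap.range (c - 1) := by
  rw [← mul_geom_sum]
  rintro _ ⟨x, rfl⟩
  exact ⟨_, rfl⟩

lemma inv_fix (t : (End F V)ˣ) (k : V) (h : (t : End F V) k = k) : ((t⁻¹ : (End F V)ˣ) : End F V) k = k := by
  conv_lhs => rw [← h]
  rw [← Module.End.mul_apply, ← Units.val_mul]; simp

lemma fr_span_le (u : V) : finrank F (Submodule.span F {u}) ≤ 1 := by
  have := finrank_span_finset_le_card (R := F) ({u} : Finset V)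
  push_cast at this
  exact this.trans (by simp)

lemma comm_rank (t t' : (End F V)ˣ) (f f' : Dual F V) (u u' : V)
    (ht : ∀ v, ((t : End F V) - 1) v = f v • u) (ht' : ∀ v, ((t' : End F V) - 1) v = f' v • u')
    (hf : f u = 0) (hf' : f' u' = 0) :
    finrank F (LinearMap.range (((t * t' * t⁻¹ * t'⁻¹ : (End F V)ˣ) : End F V) ^ A F (finrank F V) - 1)) ≤ 1 := by
  set c := t * t' * t⁻¹ * t'⁻¹ with hc
  have e : ∀ v, ((c : End F V) - 1) v = (f' (((t⁻¹ * t'⁻¹ : (End F V)ˣ) : End F V) v) * f u') • u -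
      (f (((t⁻¹ * t'⁻¹ : (End F V)ˣ) : End F V) v) * f' u) • u' := by
    intro v
    have : (c : End F V) - 1 = (((t : End F V) - 1) * ((t' : End F V) - 1) -
       ((t' : End F V) - 1) * ((t : End F V) - 1)) * ((t⁻¹ * t'⁻¹ : (End F V)ˣ) : End F V) := by
      have h1 : ((t : End F V) - 1) * ((t' : End F V) - 1) -
       ((t' : End F V) - 1) * ((t : End F V) - 1) = (t * t' : End F V) - t' * t := by noncomm_ring
      rw [h1, sub_mul]
      congr 1
      · simp [mul_assoc]
    rw [this]
    simp only [Module.End.mul_apply, LinearMap.sub_apply _ (_ * _), ht, ht', map_smul, smul_smul]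
    simp [smul_smul]
  have hle := range_pow_le (c : End F V) (A F (finrank F V))
  by_cases h1 : f u' = 0
  · have : LinearMap.range ((c : End F V) - 1) ≤ Submodule.span F {u'} := by
      rintro _ ⟨v, rfl⟩
      rw [e, h1, Submodule.mem_span_singleton]
      exact ⟨- (f (((t⁻¹ * t'⁻¹ : (End F V)ˣ) : End F V) v) * f' u), by rw [neg_smul]; simp⟩
    exact (Submodule.finrank_mono (hle.trans this)).trans (fr_span_le u')
  by_cases h2 : f' u = 0
  · have : LinearMap.range ((c : End F V) - 1) ≤ Submodule.span F {u} := by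
      rintro _ ⟨v, rfl⟩
      rw [e, h2, Submodule.mem_span_singleton]
      exact ⟨(f' (((t⁻¹ * t'⁻¹ : (End F V)ˣ) : End F V) v) * f u'), by simp⟩
    exact (Submodule.finrank_mono (hle.trans this)).trans (fr_span_le u)
  apply rank_le_one _ (Submodule.span F {u, u'}) (nil_A c)
  · classical
    have := finrank_span_finset_le_card (R := F) ({u, u'} : Finset V)
    push_cast at this
    exact this.trans Finset.card_le_two
  · refine hle.trans ?_
    rintro _ ⟨v, rfl⟩
    rw [e, Submodule.mem_span_pair]
    exact ⟨(f' (((t⁻¹ * t'⁻¹ : (End F V)ˣ) : End F V) v) * f u'), - (f (((t⁻¹ * t'⁻¹ : (End F V)ˣ) : End F V) v) * f' u), by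
      rw [neg_smul, ← sub_eq_add_neg]⟩
  · rintro _ ⟨v, rfl⟩
    let w := (f v / f u') • u' + (f' v / f' u) • u
    have hw : w ∈ Submodule.span F {u, u'} := by
      rw [Submodule.mem_span_pair]
      exact ⟨_, _, add_comm _ _⟩
    have hk1 : f (v - w) = 0 := by simp [w, hf, h1]
    have hk2 : f' (v - w) = 0 := by simp [w, hf', h2]
    have a1 : (t : End F V) (v - w) = v - w := by
      have := ht (v - w); rw [hk1, zero_smul, LinearMap.sub_apply, sub_eq_zero] at this; exact this
    have a2 : (t' : End F V) (v - w) = v - w := by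
      have := ht' (v - w); rw [hk2, zero_smul, LinearMap.sub_apply, sub_eq_zero] at this; exact this
    have a3 : (c : End F V) (v - w) = v - w := by
      simp only [hc, Units.val_mul, Module.End.mul_apply]
      rw [inv_fix _ _ a2, inv_fix _ _ a1, a2, a1]
    have a4 : ∀ k : ℕ, ((c : End F V) ^ k) (v - w) = v - w := by
      intro k
      induction k with
      | zero => simp
      | succ k ih => rw [pow_succ, Module.End.mul_apply, a3, ih]
    refine ⟨w, hw, ?_⟩
    have := a4 (A F (finrank F V))
    have h0 : ((c : End F V) ^ A F (finrank F V) - 1) (v - w) = 0 := by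
      rw [LinearMap.sub_apply, this]; simp
    rw [map_sub, sub_eq_zero] at h0
    exact h0.symm

lemma ex_dual (u u' : V) (h : u ≠ 0) (h' : u' ≠ 0) : ∃ φ : Dual F V, φ u ≠ 0 ∧ φ u' ≠ 0 := by
  obtain ⟨a, ha⟩ : ∃ φ : Dual F V, φ u ≠ 0 := by
    by_contra! hc; exact h ((Module.forall_dual_apply_eq_zero_iff F u).1 hc)
  obtain ⟨b, hb⟩ : ∃ φ : Dual F V, φ u' ≠ 0 := by
    by_contra! hc; exact h' ((Module.forall_dual_apply_eq_zero_iff F u').1 hc)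
  by_cases h1 : a u' = 0
  · by_cases h2 : b u = 0
    · exact ⟨a + b, by simpa [h2], by simpa [h1]⟩
    · exact ⟨b, h2, hb⟩
  · exact ⟨a, ha, h1⟩

lemma ex_vec (a b : Dual F V) (h : a ≠ 0) (h' : b ≠ 0) : ∃ v, a v ≠ 0 ∧ b v ≠ 0 := by
  obtain ⟨u, ha⟩ : ∃ u, a u ≠ 0 := by
    by_contra! hc; exact h (LinearMap.ext hc)
  obtain ⟨u', hb⟩ : ∃ u, b u ≠ 0 := by
    by_contra! hc; exact h' (LinearMap.ext hc)
  by_cases h1 : a u' = 0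
  · by_cases h2 : b u = 0
    · exact ⟨u + u', by simpa [h1], by simpa [h2]⟩
    · exact ⟨u, ha, h2⟩
  · exact ⟨u', h1, hb⟩

/-- unit from a dilatransvection -/
lemma ex_unit (f : Dual F V) (v : V) (h : 1 + f v ≠ 0) :
    ∃ x : (End F V)ˣ, ∀ w, (x : End F V) w = w + f w • v := by
  let e := LinearEquiv.dilatransvection (f := f) (v := v) (isUnit_iff_ne_zero.2 h)
  refine ⟨LinearMap.GeneralLinearGroup.ofLinearEquiv e, fun w => ?_⟩
  exact LinearEquiv.dilatransvection.apply (h := isUnit_iff_ne_zero.2 h)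

lemma trans_pair (u u' : V) (f f' : Dual F V) (hu : u ≠ 0) (hu' : u' ≠ 0) (hf : f ≠ 0) (hf' : f' ≠ 0)
    (h : f u = 0) (h' : f' u' = 0) :
    ∃ x : (End F V)ˣ, (x : End F V) u = u' ∧ ∀ v, f' ((x : End F V) v) = f v := by
  obtain ⟨φ, h1, h2⟩ := ex_dual (F := F) u u' hu hu'
  obtain ⟨x, hx⟩ := ex_unit ((φ u)⁻¹ • φ) (u' - u) (by
    simp only [LinearMap.smul_apply, map_sub, smul_eq_mul]
    field_simp
    simpa [h1] using h2)
  have hxu : (x : End F V) u = u' := by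
    rw [hx]; simp [h1]
  -- pull back of f'
  let f'' : Dual F V := f' ∘ₗ (x : End F V)
  have hf'' : f'' ≠ 0 := by
    intro h0
    apply hf'
    ext v
    have := LinearMap.congr_fun h0 (((x⁻¹ : (End F V)ˣ) : End F V) v)
    simp only [f'', LinearMap.comp_apply] at this
    rw [← Module.End.mul_apply, ← Units.val_mul] at this
    simpa using this
  have hf''u : f'' u = 0 := by simp [f'', hxu, h']
  obtain ⟨v, hv1, hv2⟩ := ex_vec f f'' hf hf''
  obtain ⟨z, hz⟩ := ex_unit (f - f'') ((f'' v)⁻¹ • v) (by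
    simp only [LinearMap.sub_apply, map_smul, smul_eq_mul]
    field_simp
    simpa [hv2] using hv1)
  refine ⟨x * z, ?_, ?_⟩
  · rw [Units.val_mul, Module.End.mul_apply, hz]; simp [h, hf''u, hxu]
  · intro w
    rw [Units.val_mul, Module.End.mul_apply, hz]
    change f'' _ = _
    simp [hv2]

def Wd {G : Type*} [Group G] (A B : ℕ) (x y : G) : G :=
  (y ^ A * ((x⁻¹ * y ^ B * x)⁻¹ * y ^ A * (x⁻¹ * y ^ B * x)) * (y ^ A)⁻¹ *
    ((x⁻¹ * y ^ B * x)⁻¹ * y ^ A * (x⁻¹ * y ^ B * x))⁻¹) ^ A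

lemma conj_form (t g : (End F V)ˣ) (f : Dual F V) (u : V) (ht : ∀ v, ((t : End F V) - 1) v = f v • u) :
    ∀ v, (((g⁻¹ * t * g : (End F V)ˣ) : End F V) - 1) v =
      (f ∘ₗ (g : End F V)) v • ((g⁻¹ : (End F V)ˣ) : End F V) u := by
  intro v
  have : ((g⁻¹ * t * g : (End F V)ˣ) : End F V) - 1 =
      ((g⁻¹ : (End F V)ˣ) : End F V) * ((t : End F V) - 1) * (g : End F V) := by
    rw [mul_sub, sub_mul]; simp
  rw [this, Module.End.mul_apply, Module.End.mul_apply, ht, map_smul]; rfl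

lemma inv_apply' (g : (End F V)ˣ) (v : V) : (g : End F V) (((g⁻¹ : (End F V)ˣ) : End F V) v) = v := by
  rw [← Module.End.mul_apply, ← Units.val_mul]; simp

lemma inv_apply (g : (End F V)ˣ) (v : V) : ((g⁻¹ : (End F V)ˣ) : End F V) ((g : End F V) v) = v := by
  rw [← Module.End.mul_apply, ← Units.val_mul]; simp

lemma upper (m L : ℕ) (hm : 3 ≤ m) (hn : finrank F V = m + 2)
    (hL : ∀ i, 1 ≤ i → i ≤ m + 2 → i ≠ m → Fintype.card F ^ i - 1 ∣ L) (x y : (End F V)ˣ) :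
    finrank F (LinearMap.range (((Wd (A F (finrank F V)) (L * Fintype.card F ^ finrank F V) x y :
      (End F V)ˣ) : End F V) - 1)) ≤ 1 := by
  by_cases hB : (y : End F V) ^ (L * Fintype.card F ^ finrank F V) = 1
  · have hB' : y ^ (L * Fintype.card F ^ finrank F V) = 1 := by
      ext1; simpa using hB
    have : Wd (A F (finrank F V)) (L * Fintype.card F ^ finrank F V) x y = 1 := by
      unfold Wd
      rw [hB']; simp
    rw [this, Units.val_one, sub_self, LinearMap.range_zero, finrank_bot]
    omega
  · have h1 := rank_A y m L hm hn hL hB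
    obtain ⟨f, u, hfu, h0⟩ := exists_uf _ h1 (nil_A y)
    unfold Wd
    rw [Units.val_pow_eq_pow_val]
    rw [← Units.val_pow_eq_pow_val] at hfu
    refine comm_rank _ _ f _ u _ hfu (conj_form _ _ f u hfu) h0 ?_
    rw [LinearMap.comp_apply, inv_apply', h0]

lemma pow_form (c : End F V) (φ : Dual F V) (u : V) (hc : ∀ v, (c - 1) v = φ v • u) (h : φ u = 0)
    (k : ℕ) (v : V) : (c ^ k - 1) v = ((k : F) * φ v) • u := by
  have hc' : ∀ v, c v = v + φ v • u := by
    intro v; rw [← hc v]; simp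
  have : ∀ v, (c ^ k) v = v + ((k : F) * φ v) • u := by
    intro v
    induction k with
    | zero => simp
    | succ k ih =>
      rw [pow_succ', Module.End.mul_apply, ih, hc', map_add, map_smul, h]
      push_cast
      module
  rw [LinearMap.sub_apply, this]; simp

lemma lower_aux (t g : (End F V)ˣ) (f : Dual F V) (u : V) (ht : ∀ v, ((t : End F V) - 1) v = f v • u)
    (hu : u ≠ 0) (hf : f ≠ 0)
    (hfu : f u = 0) (h1 : f ((g : End F V) u) = 0)
    (h2 : f (((g⁻¹ : (End F V)ˣ) : End F V) u) ≠ 0) (n : ℕ) :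
    (t * (g⁻¹ * t * g) * t⁻¹ * (g⁻¹ * t * g)⁻¹) ^ A F n ≠ 1 := by
  set t' := g⁻¹ * t * g with ht'd
  have ht' := conj_form t g f u ht
  rw [← ht'd] at ht'
  set f' := f ∘ₗ (g : End F V) with hf'
  set u' := ((g⁻¹ : (End F V)ˣ) : End F V) u with hu'
  have hf'u : f' u = 0 := h1
  have tu : (t : End F V) u = u := by
    have := ht u; rw [hfu, zero_smul, LinearMap.sub_apply, sub_eq_zero] at this; exact this
  have tu' : (t' : End F V) u = u := by
    have := ht' u; rw [hf'u, zero_smul, LinearMap.sub_apply, sub_eq_zero] at this; exact this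
  obtain ⟨w, hw⟩ : ∃ w, f' w ≠ 0 := by
    by_contra! hc
    apply hf
    ext v
    have := hc (((g⁻¹ : (End F V)ˣ) : End F V) v)
    rw [hf', LinearMap.comp_apply, inv_apply'] at this
    simpa using this
  let φ : Dual F V := f u' • (f' ∘ₗ ((t⁻¹ * t'⁻¹ : (End F V)ˣ) : End F V))
  have e : ∀ v, (((t * t' * t⁻¹ * t'⁻¹ : (End F V)ˣ) : End F V) - 1) v = φ v • u := by
    intro v
    have : ((t * t' * t⁻¹ * t'⁻¹ : (End F V)ˣ) : End F V) - 1 = (((t : End F V) - 1) * ((t' : End F V) - 1) -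
       ((t' : End F V) - 1) * ((t : End F V) - 1)) * ((t⁻¹ * t'⁻¹ : (End F V)ˣ) : End F V) := by
      have h1 : ((t : End F V) - 1) * ((t' : End F V) - 1) -
       ((t' : End F V) - 1) * ((t : End F V) - 1) = (t * t' : End F V) - t' * t := by noncomm_ring
      rw [h1, sub_mul, ← Units.val_mul, ← Units.val_mul, ← Units.val_mul, ← Units.val_mul]
      simp [mul_assoc]
    rw [this]
    simp only [Module.End.mul_apply, LinearMap.sub_apply _ (_ * _), ht, ht', map_smul, hf'u, φ]
    simp [smul_smul, mul_comm]
  have hφu : φ u = 0 := by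
    simp only [φ, LinearMap.smul_apply, LinearMap.comp_apply, Units.val_mul, Module.End.mul_apply]
    rw [inv_fix _ _ tu', inv_fix _ _ tu, hf'u, smul_zero]
  intro hone
  have hp := pow_form _ φ u e hφu (A F n) ((t' : End F V) ((t : End F V) w))
  rw [← Units.val_pow_eq_pow_val, hone] at hp
  have : φ ((t' : End F V) ((t : End F V) w)) = f u' * f' w := by
    simp only [φ, LinearMap.smul_apply, LinearMap.comp_apply, Units.val_mul, Module.End.mul_apply,
      inv_apply, smul_eq_mul]
  rw [this] at hp
  simp only [Units.val_one, sub_self, LinearMap.zero_apply] at hp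
  rcases smul_eq_zero.1 hp.symm with h | h
  · exact mul_ne_zero (A_ne n) (mul_ne_zero h2 hw) h
  · exact hu h

lemma ex_mu (m L : ℕ) (hm : 3 ≤ m) (hL : ¬ (Fintype.card F ^ m - 1 ∣ L * (Fintype.card F - 1)))
    (E : Type) [Field E] [Algebra F E] [Finite E] (hE : finrank F E = m) (N : ℕ) :
    ∃ l : E, l ≠ 0 ∧ l ^ (Fintype.card F ^ m - 1) = 1 ∧
      ∀ a : F, l ^ (L * Fintype.card F ^ N) ≠ algebraMap F E a := by
  have : Module.Finite F E := Module.finite_of_finrank_pos (by omega)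
  have hcard : Nat.card E = Fintype.card F ^ m := by
    rw [Module.natCard_eq_pow_finrank (K := F), Nat.card_eq_fintype_card, hE]
  obtain ⟨g, hg⟩ := IsCyclic.exists_ofOrder_eq_natCard (α := Eˣ)
  rw [Nat.card_units, hcard] at hg
  refine ⟨g, g.ne_zero, ?_, ?_⟩
  · rw [← hg]
    rw [← Units.val_pow_eq_pow_val, pow_orderOf_eq_one, Units.val_one]
  · intro a ha
    have ha0 : a ≠ 0 := by
      rintro rfl
      rw [map_zero] at ha
      exact pow_ne_zero _ g.ne_zero ha
    have h1 : (g : E) ^ ((L * Fintype.card F ^ N) * (Fintype.card F - 1)) = 1 := by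
      rw [pow_mul, ha, ← map_pow, FiniteField.pow_card_sub_one_eq_one a ha0, map_one]
    have h2 : g ^ ((L * Fintype.card F ^ N) * (Fintype.card F - 1)) = 1 := by
      ext1; simpa using h1
    have h3 := orderOf_dvd_of_pow_eq_one h2
    rw [hg] at h3
    apply hL
    have hcop : Nat.Coprime (Fintype.card F ^ m - 1) (Fintype.card F ^ N) := by
      apply Nat.Coprime.pow_right
      have h1 : 1 ≤ Fintype.card F ^ m := Nat.one_le_pow _ _ Fintype.card_pos
      have hc : Nat.Coprime (Fintype.card F ^ m - 1) (Fintype.card F ^ m) := by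
        have := (Nat.coprime_self_add_right (m := Fintype.card F ^ m - 1) (n := 1)).2 (Nat.coprime_one_right _)
        rwa [Nat.sub_add_cancel h1] at this
      exact hc.coprime_dvd_right (dvd_pow_self _ (by omega))
    apply hcop.dvd_of_dvd_mul_right
    convert h3 using 1
    ring

lemma lower (m L : ℕ) (hm : 3 ≤ m) (hL : ¬ (Fintype.card F ^ m - 1 ∣ L * (Fintype.card F - 1)))
    (E : Type) [Field E] [Algebra F E] [Finite E] (hE : finrank F E = m) :
    ∃ x y : (End F (E × F × F))ˣ,
      Wd (A F (m+2)) (L * Fintype.card F ^ (m + 2)) x y ≠ 1 := by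
  have : Module.Finite F E := Module.finite_of_finrank_pos (by omega)
  obtain ⟨l, hl0, hl1, hl⟩ := ex_mu m L hm hL E hE (m+2)
  set B := L * Fintype.card F ^ (m + 2) with hB
  let y0 : End F (E × F × F) :=
    { toFun := fun v => (l * v.1, v.2.1 + v.2.2, v.2.2)
      map_add' := by intro a b; ext <;> simp <;> ring
      map_smul' := by intro a b; ext <;> simp <;> ring }
  have hy0 : IsUnit y0 := by
    rw [LinearMap.isUnit_iff_ker_eq_bot, eq_bot_iff]
    rintro ⟨e, a, b⟩ h
    have h : (l * e, a + b, b) = (0 : E × F × F) := h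
    simp [Prod.ext_iff, hl0] at h
    obtain ⟨h1, h2, h3⟩ := h
    simp [h1, h3] at h2 ⊢
    exact h2
  obtain ⟨y, hy⟩ := hy0
  have hyk : ∀ (k : ℕ) (v : E × F × F), ((y : End F (E × F × F)) ^ k) v = (l ^ k * v.1, v.2.1 + k * v.2.2, v.2.2) := by
    intro k
    induction k with
    | zero => intro v; simp
    | succ k ih =>
      intro v
      rw [pow_succ', Module.End.mul_apply, ih, hy]
      change (l * (l ^ k * v.1), v.2.1 + k * v.2.2 + v.2.2, v.2.2) = _
      ext <;> simp <;> ring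
  let u : E × F × F := (0, 1, 0)
  let f : Dual F (E × F × F) := (A F (m+2) : F) • (LinearMap.snd F F F ∘ₗ LinearMap.snd F E (F × F))
  have hfapp : ∀ v, f v = (A F (m+2) : F) * v.2.2 := fun v => rfl
  have hA : l ^ A F (m+2) = 1 := by
    obtain ⟨k, hk⟩ := dvd_A (F := F) (m+2) m (by omega) (by omega)
    rw [hk, pow_mul, hl1, one_pow]
  have ht : ∀ v, (((y ^ A F (m+2) : (End F (E × F × F))ˣ) : End F (E × F × F)) - 1) v = f v • u := by
    intro v
    rw [LinearMap.sub_apply, Units.val_pow_eq_pow_val, hyk, hfapp, hA]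
    ext <;> simp [u]
  have hB0 : (B : F) = 0 := by
    rw [hB]; push_cast; simp
  have hgB : ∀ v, ((y ^ B : (End F (E × F × F))ˣ) : End F (E × F × F)) v = (l ^ B * v.1, v.2) := by
    intro v
    rw [Units.val_pow_eq_pow_val, hyk, hB0]
    ext <;> simp
  set mu := l ^ B with hmu
  have hmu0 : mu ≠ 0 := pow_ne_zero _ hl0
  have hgBi : ∀ v, (((y ^ B)⁻¹ : (End F (E × F × F))ˣ) : End F (E × F × F)) v = (mu⁻¹ * v.1, v.2) := by
    intro v
    have h := inv_apply (y ^ B) (mu⁻¹ * v.1, v.2)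
    rw [hgB] at h
    rw [← h]
    congr 1
    ext <;> simp [hmu0]
  let U : E × F × F := (1, 1, 0)
  obtain ⟨Φ, hΦ1, hΦ2⟩ := Submodule.exists_le_ker_of_notMem
    (p := Submodule.span F {U, (mu, (1:F), (0:F))}) (v := (mu⁻¹, (1:F), (0:F))) (by
      rw [Submodule.mem_span_pair]
      rintro ⟨a, b, hab⟩
      simp only [U, Prod.smul_mk, Prod.mk_add_mk, Prod.mk.injEq, smul_eq_mul, mul_one] at hab
      obtain ⟨h1, h2, -⟩ := hab
      rw [Algebra.smul_def, Algebra.smul_def, mul_one] at h1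
      have ha : algebraMap F E a = 1 - algebraMap F E b := by
        rw [← map_one (algebraMap F E), ← h2]; simp
      rw [ha] at h1
      field_simp at h1
      have h3 : (mu - 1) * (algebraMap F E b * mu + 1) = 0 := by linear_combination h1
      rcases mul_eq_zero.1 h3 with h | h
      · exact hl 1 (by rw [map_one]; exact sub_eq_zero.1 h)
      · have hb : b ≠ 0 := by rintro rfl; simp at h
        have hb' : algebraMap F E b ≠ 0 := by simpa using hb
        apply hl (-b⁻¹)
        rw [map_neg, map_inv₀]
        field_simp
        linear_combination h)
  have hΦU : Φ U = 0 := hΦ2 (Submodule.subset_span (by simp))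
  have hΦgU : Φ (mu, (1:F), (0:F)) = 0 := hΦ2 (Submodule.subset_span (by simp))
  have hf0 : f ≠ 0 := by
    intro h
    have := LinearMap.congr_fun h (0, 0, 1)
    rw [hfapp] at this
    simp at this
    exact A_ne _ this
  obtain ⟨x, hxu, hxf⟩ := trans_pair u U f Φ (by simp [u]) (by simp [U]) hf0
    (by rintro rfl; simp at hΦ1) (by simp [hfapp, u]) hΦU
  refine ⟨x, y, ?_⟩
  unfold Wd
  refine lower_aux (y ^ A F (m+2)) (x⁻¹ * y ^ B * x) f u ht (by simp [u]) hf0 (by simp [hfapp, u]) ?_ ?_ _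
  · rw [Units.val_mul, Units.val_mul, Module.End.mul_apply, Module.End.mul_apply, hxu, hgB, ← hxf,
      inv_apply']
    simpa [U] using hΦgU
  · have : (x⁻¹ * y ^ B * x)⁻¹ = x⁻¹ * (y ^ B)⁻¹ * x := by group
    rw [this]
    rw [Units.val_mul, Units.val_mul, Module.End.mul_apply, Module.End.mul_apply, hxu, hgBi, ← hxf,
      inv_apply']
    simpa [U] using hΦ1

lemma lift_map {G H : Type} [Group G] [Group H] (e : G →* H) (φ : Fin 2 → G)
    (w : FreeGroup (Fin 2)) : FreeGroup.lift (fun i => e (φ i)) w = e (FreeGroup.lift φ w) := by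
  have : FreeGroup.lift (fun i => e (φ i)) = e.comp (FreeGroup.lift φ) := by
    ext i; simp
  rw [this]; rfl

lemma ne_pair (N : End F V) (hN : N ≠ 0) (f : Dual F V) (u : V) (h : ∀ v, N v = f v • u) :
    u ≠ 0 ∧ f ≠ 0 := by
  constructor
  · rintro rfl
    exact hN (LinearMap.ext fun v => by simp [h])
  · rintro rfl
    exact hN (LinearMap.ext fun v => by simp [h])

lemma conj_pair (h g x : (End F V)ˣ) (u u' : V) (f f' : Dual F V)
    (hh : ∀ v, ((h : End F V) - 1) v = f' v • u') (hg : ∀ v, ((g : End F V) - 1) v = f v • u)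
    (hx : (x : End F V) u = u') (hx2 : ∀ v, f' ((x : End F V) v) = f v) : x⁻¹ * h * x = g := by
  have : h * x = x * g := by
    ext v
    have h1 := hh ((x : End F V) v)
    have h2 := hg v
    rw [LinearMap.sub_apply, Module.End.one_apply, sub_eq_iff_eq_add] at h1 h2
    rw [Units.val_mul, Units.val_mul, Module.End.mul_apply, Module.End.mul_apply, h1, h2, map_add,
      map_smul, hx, hx2]
  rw [mul_assoc, this, inv_mul_cancel_left]

lemma val_ne (h : (End F V)ˣ) (hh : h ≠ 1) : (h : End F V) - 1 ≠ 0 := by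
  intro h0
  apply hh
  ext1
  rw [Units.val_one]
  exact sub_eq_zero.1 h0

lemma range_inv (h : (End F V)ˣ) : LinearMap.range ((h : End F V) - 1) ≤
    LinearMap.range (((h⁻¹ : (End F V)ˣ) : End F V) - 1) := by
  rintro _ ⟨v, rfl⟩
  refine ⟨-((h : End F V) v), ?_⟩
  rw [LinearMap.sub_apply, LinearMap.sub_apply, map_neg, inv_apply h v]
  simp only [Module.End.one_apply]
  abel

lemma assembly (n : ℕ) (hn : 1 ≤ n) (w : FreeGroup (Fin 2))
    (h1 : ∀ φ : Fin 2 → (End F (Fin n → F))ˣ, (∃ z, FreeGroup.lift φ w = z ^ A F n) ∧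
      finrank F (LinearMap.range ((FreeGroup.lift φ w : End F (Fin n → F)) - 1)) ≤ 1)
    (h2 : ∃ φ : Fin 2 → (End F (Fin n → F))ˣ, FreeGroup.lift φ w ≠ 1) :
    wordValues w (GL (Fin n) F) = {g : GL (Fin n) F | g = 1 ∨ IsGLTransvection g} := by
  let e : GL (Fin n) F ≃* (End F (Fin n → F))ˣ := Matrix.GeneralLinearGroup.toLin
  have hfr : finrank F (Fin n → F) = n := by simp
  have he : ∀ g : GL (Fin n) F, ((e g : End F (Fin n → F)) - 1) =
      Matrix.toLin' ((g : Matrix (Fin n) (Fin n) F) - 1) := by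
    intro g
    rw [map_sub, Matrix.toLin'_one]
    rfl
  have hrk : ∀ g : GL (Fin n) F, ((g : Matrix (Fin n) (Fin n) F) - 1).rank =
      finrank F (LinearMap.range ((e g : End F (Fin n → F)) - 1)) := by
    intro g
    rw [he]; rfl
  have key : ∀ g : GL (Fin n) F, (∃ z, e g = z ^ A F n) →
      finrank F (LinearMap.range ((e g : End F (Fin n → F)) - 1)) ≤ 1 →
      g = 1 ∨ IsGLTransvection g := by
    rintro g ⟨z, hz⟩ hr
    by_cases hg : g = 1
    · exact Or.inl hg
    right
    have hne : (e g : End F (Fin n → F)) - 1 ≠ 0 := val_ne _ (by simpa using hg)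
    have hnil : IsNilpotent ((e g : End F (Fin n → F)) - 1) := by
      rw [hz, Units.val_pow_eq_pow_val]
      have := nil_A z
      rwa [hfr] at this
    obtain ⟨f, u, hf, hfu⟩ := exists_uf _ hr hnil
    refine ⟨hg, ?_, ?_, ?_⟩
    · have hz' : g = (e.symm z) ^ A F n := by
        rw [← map_pow, ← hz, e.symm_apply_apply]
      rw [hz', Units.val_pow_eq_pow_val, Matrix.det_pow]
      obtain ⟨k, hk⟩ := dvd_A (F := F) n 1 le_rfl hn
      rw [hk, pow_mul, pow_one, FiniteField.pow_card_sub_one_eq_one, one_pow]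
      exact Matrix.GeneralLinearGroup.det_ne_zero _
    · rw [hrk]
      have : finrank F (LinearMap.range ((e g : End F (Fin n → F)) - 1)) ≠ 0 := by
        intro h0
        rw [Submodule.finrank_eq_zero, LinearMap.range_eq_bot] at h0
        exact hne h0
      omega
    · apply Matrix.toLin'.injective
      rw [map_zero, Matrix.toLin'_pow, ← he]
      ext1 i
      apply LinearMap.ext
      intro v
      rw [LinearMap.comp_apply, pow_two, Module.End.mul_apply, hf, hf, map_smul, hfu]
      simp
  ext g
  constructor
  · rintro ⟨φ, hφ⟩
    have h3 := h1 (fun i => e (φ i))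
    have h4 := lift_map e.toMonoidHom φ w
    change FreeGroup.lift (fun i => e (φ i)) w = e _ at h4
    rw [h4] at h3
    obtain ⟨⟨z, hz⟩, hr⟩ := h3
    rcases hφ with hφ | hφ
    · rw [hφ] at hz hr
      exact key g ⟨z, hz⟩ hr
    · rw [hφ] at hz hr
      apply key g
      · refine ⟨z⁻¹, ?_⟩
        rw [inv_pow, ← hz, map_inv, inv_inv]
      · refine le_trans (Submodule.finrank_mono ?_) hr
        rw [map_inv]
        exact range_inv (e g)
  · rintro (rfl | ⟨hg1, -, hgr, hg2⟩)
    · refine ⟨fun _ => 1, Or.inl ?_⟩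
      have := lift_map (1 : GL (Fin n) F →* GL (Fin n) F) (fun _ => 1) w
      simpa using this
    · obtain ⟨φ, hφ⟩ := h2
      obtain ⟨⟨z, hz⟩, hr⟩ := h1 φ
      have hnil : IsNilpotent ((FreeGroup.lift φ w : End F (Fin n → F)) - 1) := by
        rw [hz, Units.val_pow_eq_pow_val]
        have := nil_A z
        rwa [hfr] at this
      obtain ⟨f', u', hf', hfu'⟩ := exists_uf _ hr hnil
      obtain ⟨hu'0, hf'0⟩ := ne_pair _ (val_ne _ hφ) f' u' hf'
      have hne : (e g : End F (Fin n → F)) - 1 ≠ 0 := val_ne _ (by simpa using hg1)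
      have hnilg : IsNilpotent ((e g : End F (Fin n → F)) - 1) := by
        refine ⟨2, ?_⟩
        rw [he, ← Matrix.toLin'_pow, hg2, map_zero]
      rw [hrk] at hgr
      obtain ⟨f, u, hf, hfu⟩ := exists_uf _ hgr.le hnilg
      obtain ⟨hu0, hf0⟩ := ne_pair _ hne f u hf
      obtain ⟨x, hx1, hx2⟩ := trans_pair u u' f f' hu0 hu'0 hf0 hf'0 hfu hfu'
      have hc := conj_pair _ (e g) x u u' f f' hf' hf hx1 hx2
      let c : (End F (Fin n → F))ˣ →* GL (Fin n) F :=
        e.symm.toMonoidHom.comp (MulAut.conj x⁻¹).toMonoidHom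
      refine ⟨fun i => c (φ i), Or.inl ?_⟩
      rw [lift_map]
      change e.symm (x⁻¹ * _ * x⁻¹⁻¹) = g
      rw [inv_inv, hc, e.symm_apply_apply]

lemma Wd_map {G H : Type} [Group G] [Group H] (e : G →* H) (a b : ℕ) (x y : G) :
    e (Wd a b x y) = Wd a b (e x) (e y) := by
  simp [Wd]

lemma lower_pi (m L : ℕ) (hm : 3 ≤ m)
    (hL : ¬ (Fintype.card F ^ m - 1 ∣ L * (Fintype.card F - 1))) :
    ∃ x y : (End F (Fin (m+2) → F))ˣ,
      Wd (A F (m+2)) (L * Fintype.card F ^ (m + 2)) x y ≠ 1 := by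
  obtain ⟨p, hp⟩ := CharP.exists F
  have : Fact p.Prime := ⟨CharP.char_is_prime F p⟩
  have : NeZero m := ⟨by omega⟩
  have hE : finrank F (FiniteField.Extension F p m) = m := FiniteField.finrank_extension F p m
  obtain ⟨x, y, h⟩ := lower m L hm hL (FiniteField.Extension F p m) hE
  have hfr : finrank F (FiniteField.Extension F p m × F × F) = finrank F (Fin (m+2) → F) := by
    simp [hE]
  let e : (End F (FiniteField.Extension F p m × F × F))ˣ ≃* (End F (Fin (m+2) → F))ˣ :=
    LinearMap.GeneralLinearGroup.congrLinearEquiv (LinearEquiv.ofFinrankEq _ _ hfr)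
  refine ⟨e x, e y, ?_⟩
  have := Wd_map e.toMonoidHom (A F (m+2)) (L * Fintype.card F ^ (m + 2)) x y
  change e _ = Wd _ _ (e x) (e y) at this
  rw [← this]
  simpa using h

lemma case_two : ∃ w : FreeGroup (Fin 2),
      wordValues w (GL (Fin 2) F) = {g : GL (Fin 2) F | g = 1 ∨ IsGLTransvection g} := by
  refine ⟨(FreeGroup.of 0) ^ A F 2, assembly 2 (by norm_num) _ ?_ ?_⟩
  · intro φ
    have h : FreeGroup.lift φ ((FreeGroup.of 0) ^ A F 2) = φ 0 ^ A F 2 := by simp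
    refine ⟨⟨_, h⟩, ?_⟩
    rw [h, Units.val_pow_eq_pow_val]
    have hnil := nil_A (φ 0)
    rw [show finrank F (Fin 2 → F) = 2 by simp] at hnil
    refine rank_le_one _ ⊤ hnil (by simp) le_top ?_
    rw [Submodule.map_top]
  · let f : Dual F (Fin 2 → F) := LinearMap.proj 1
    let u : Fin 2 → F := Pi.single 0 1
    have hfu : f u = 0 := by simp [f, u]
    obtain ⟨x, hx⟩ := ex_unit f u (by simp [hfu])
    refine ⟨fun _ => x, ?_⟩
    intro h
    have h : x ^ A F 2 = 1 := by simpa using h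
    have h5 := pow_form x f u (fun v => by simp [hx]) hfu (A F 2) (Pi.single 1 1)
    have h6 : (x : End F (Fin 2 → F)) ^ A F 2 = 1 := by
      rw [← Units.val_pow_eq_pow_val, h, Units.val_one]
    simp only [h, h6, Units.val_one] at h5
    have := congrFun h5 0
    simp [f, u] at this
    exact A_ne _ this.symm

lemma case_big (m : ℕ) (hm : 3 ≤ m) : ∃ w : FreeGroup (Fin 2),
      wordValues w (GL (Fin (m+2)) F) =
        {g : GL (Fin (m+2)) F | g = 1 ∨ IsGLTransvection g} := by
  obtain ⟨L, hL0, hL1, hL2⟩ := exists_L (Fintype.card F) m Fintype.one_lt_card hm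
  have hfr : finrank F (Fin (m+2) → F) = m + 2 := by simp
  have hw : ∀ φ : Fin 2 → (End F (Fin (m+2) → F))ˣ,
      FreeGroup.lift φ (Wd (A F (m+2)) (L * Fintype.card F ^ (m + 2)) (FreeGroup.of 0)
        (FreeGroup.of 1)) = Wd (A F (m+2)) (L * Fintype.card F ^ (m + 2)) (φ 0) (φ 1) := by
    intro φ
    rw [Wd_map]; simp
  refine ⟨Wd (A F (m+2)) (L * Fintype.card F ^ (m + 2)) (FreeGroup.of 0) (FreeGroup.of 1),
    assembly (m+2) (by omega) _ ?_ ?_⟩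
  · intro φ
    rw [hw]
    refine ⟨⟨_, rfl⟩, ?_⟩
    have := upper m L hm hfr hL1 (φ 0) (φ 1)
    rwa [hfr] at this
  · obtain ⟨x, y, h⟩ := lower_pi (F := F) m L hm hL2
    refine ⟨![x, y], ?_⟩
    rw [hw]
    exact h

end TV

theorem stmt19 (n : ℕ) (hn : 2 ≤ n) (h3 : n ≠ 3) (h4 : n ≠ 4)
    (F : Type) [Field F] [Fintype F] :
    ∃ w : FreeGroup (Fin 2),
      wordValues w (GL (Fin n) F) =
        {g : GL (Fin n) F | g = 1 ∨ IsGLTransvection g} := by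
  rcases Nat.eq_or_lt_of_le hn with h | h
  · subst h
    exact TV.case_two
  · obtain ⟨m, rfl⟩ : ∃ m, n = m + 2 := ⟨n - 2, by omega⟩
    exact TV.case_big m (by omega)
end
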